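/- Let (Q, ≤_Q) be a bqo. Then (C'_{ω₁}, ⪯), the class of Q-cclos generated from singletons by unbounded sums, is a bqo under smc-embeddability ⪯. -/

import Mathlib

open Set Filter Topology

/-- A `Q`-labeled countable closed linear ordering (`Q`-cclo): a function whose
domain is a countable closed subset of `ℝ` and whose values lie in `Q`. -/
structure QCclo (Q : Type) where
  dom : Set ℝ
  dom_countable : dom.Countable
  dom_closed : IsClosed dom
  val : ℝ → Q

/-- `h` is a strictly monotone continuous (smc-) embedding of `V₁` into `V₂`. -/
def IsSmcEmbedding (V₁ V₂ : Set ℝ) (h : ℝ → ℝ) : Prop :=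
  (∀ x ∈ V₁, h x ∈ V₂) ∧
  (∀ x ∈ V₁, ∀ y ∈ V₁, x < y → h x < h y) ∧
  ContinuousOn h V₁

/-- `A ⪯ B`: there is an smc-embedding of `dom A` into `dom B` increasing labels. -/
def QCclo.Emb {Q : Type} [Preorder Q] (A B : QCclo Q) : Prop :=
  ∃ h : ℝ → ℝ, IsSmcEmbedding A.dom B.dom h ∧ ∀ a ∈ A.dom, A.val a ≤ B.val (h a)

/-- Bi-embeddability of `Q`-cclos. -/
def QCclo.Equiv {Q : Type} [Preorder Q] (A B : QCclo Q) : Prop :=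
  QCclo.Emb A B ∧ QCclo.Emb B A

/-- `A < B` for domains: one of them is empty, or they are separated
by an open interval (here witnessed by a point strictly between them). -/
def DomLt (A B : Set ℝ) : Prop :=
  A = ∅ ∨ B = ∅ ∨ ∃ c : ℝ, (∀ a ∈ A, a < c) ∧ ∀ b ∈ B, c < b

/-- `L` is the sum `L₀ + L₁ + ⋯ + p + ⋯ + ¹L + ⁰L` (with `Ls n = L_n`,
`Rs n = ⁿL`, central point `x` labeled `p`). -/
def IsOmegaSum {Q : Type} (L : QCclo Q) (Ls Rs : ℕ → QCclo Q) (p : Q) (x : ℝ) : Prop :=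
  ((∀ n, (Ls n).dom = ∅) ∨ ∀ n, (Ls n).dom.Nonempty) ∧
  ((∀ n, (Rs n).dom = ∅) ∨ ∀ n, (Rs n).dom.Nonempty) ∧
  (¬ ((∀ n, (Ls n).dom = ∅) ∧ ∀ n, (Rs n).dom = ∅)) ∧
  (∀ n, DomLt (Ls n).dom (Ls (n+1)).dom) ∧
  (∀ n, DomLt (Ls (n+1)).dom (Rs (n+1)).dom) ∧
  (∀ n, DomLt (Rs (n+1)).dom (Rs n).dom) ∧
  (∀ a : ℕ → ℝ, (∀ n, a n ∈ (Ls n).dom) → Tendsto a atTop (𝓝 x)) ∧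
  (∀ a : ℕ → ℝ, (∀ n, a n ∈ (Rs n).dom) → Tendsto a atTop (𝓝 x)) ∧
  L.dom = (⋃ n, (Ls n).dom) ∪ {x} ∪ ⋃ n, (Rs n).dom ∧
  (∀ n, ∀ y ∈ (Ls n).dom, L.val y = (Ls n).val y) ∧
  (∀ n, ∀ y ∈ (Rs n).dom, L.val y = (Rs n).val y) ∧
  L.val x = p

/-- `L` is the finite sum `L₁ + ⋯ + L_n` of the nonempty `Q`-cclos `Ls 0, …, Ls (n-1)`. -/
def IsFinSum {Q : Type} (L : QCclo Q) (n : ℕ) (Ls : Fin n → QCclo Q) : Prop :=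
  0 < n ∧ (∀ i, (Ls i).dom.Nonempty) ∧
  (∀ i j : Fin n, i < j → ∀ a ∈ (Ls i).dom, ∀ b ∈ (Ls j).dom, a < b) ∧
  L.dom = ⋃ i, (Ls i).dom ∧
  ∀ i, ∀ y ∈ (Ls i).dom, L.val y = (Ls i).val y

/-- `S(𝒪)`: finite sums and ω-sums of members of `𝒪`. -/
def SSum {Q : Type} (O : Set (QCclo Q)) : Set (QCclo Q) :=
  {L | (∃ n Ls, IsFinSum L n Ls ∧ ∀ i, Ls i ∈ O) ∨
       ∃ Ls Rs p x, IsOmegaSum L Ls Rs p x ∧ (∀ n, Ls n ∈ O) ∧ ∀ n, Rs n ∈ O}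

/-- `S'(𝒪)`: unbounded ω-sums of members of `𝒪`. -/
def S'Sum {Q : Type} [Preorder Q] (O : Set (QCclo Q)) : Set (QCclo Q) :=
  {L | ∃ Ls Rs p x, IsOmegaSum L Ls Rs p x ∧ (∀ n, Ls n ∈ O) ∧ (∀ n, Rs n ∈ O) ∧
       (∀ n, ∃ k > n, QCclo.Emb (Ls n) (Ls k)) ∧
       ∀ n, ∃ k > n, QCclo.Emb (Rs n) (Rs k)}

/-- The hierarchy `C_α`: `C₀` = empty/singleton domains, `C_{α+1} = S(C_α) ∪ C_α`,
unions at limits. -/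
noncomputable def CFam (Q : Type) [Preorder Q] : Ordinal → Set (QCclo Q) := fun α =>
  Ordinal.limitRecOn α
    {L : QCclo Q | L.dom = ∅ ∨ ∃ x : ℝ, L.dom = {x}}
    (fun _ C => SSum C ∪ C)
    (fun _ _ ih => ⋃ (β : Ordinal) (h : β < _), ih β h)

/-- The hierarchy `C'_α`: `C'₀` = empty/singleton domains, `C'_{α+1} = S'(C'_α) ∪ C'_α`,
unions at limits. -/
noncomputable def CFam' (Q : Type) [Preorder Q] : Ordinal → Set (QCclo Q) := fun α =>
  Ordinal.limitRecOn α
    {L : QCclo Q | L.dom = ∅ ∨ ∃ x : ℝ, L.dom = {x}}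
    (fun _ C => S'Sum C ∪ C)
    (fun _ _ ih => ⋃ (β : Ordinal) (h : β < _), ih β h)

/-- A sequence is good for `r` iff `r (f n) (f k)` for some `n < k`;
`r` is a wqo on `S` iff every sequence in `S` is good. -/
def IsWqoOn {P : Type*} (r : P → P → Prop) (S : Set P) : Prop :=
  ∀ f : ℕ → P, (∀ n, f n ∈ S) → ∃ n k, n < k ∧ r (f n) (f k)

/-- `d` extends the finite set `c`: `c = {i ∈ d : i ≤ max c}`. -/
def SExtends (d : Set ℕ) (c : Finset ℕ) : Prop :=
  (c : Set ℕ) = {i ∈ d | ∃ m ∈ c, i ≤ m}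

/-- `B` is a block: an infinite set of finite subsets of `ℕ` such that every infinite
subset of `⋃ B` has an initial segment in `B`. -/
def IsBlock (B : Set (Finset ℕ)) : Prop :=
  B.Infinite ∧
  ∀ X : Set ℕ, X.Infinite → X ⊆ (⋃ b ∈ B, (b : Set ℕ)) → ∃ b ∈ B, SExtends X b

/-- A barrier: a block with no two elements comparable under inclusion. -/
def IsBarrier (B : Set (Finset ℕ)) : Prop :=
  IsBlock B ∧ ∀ b₁ ∈ B, ∀ b₂ ∈ B, b₁ ≠ b₂ → ¬ b₁ ⊆ b₂

/-- Precedence `b₁ ◁ b₂`: there are `i₁ < i₂ < ⋯ < i_m` with `b₁ = {i₁,…,i_k}`,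
`b₂ = {i₂,…,i_m}`, `1 ≤ k < m`. -/
def BarrierPrec (b₁ b₂ : Finset ℕ) : Prop :=
  ∃ (m k : ℕ) (i : ℕ → ℕ), 1 ≤ k ∧ k < m ∧
    StrictMonoOn i (Set.Icc 1 m) ∧
    b₁ = (Finset.Icc 1 k).image i ∧ b₂ = (Finset.Icc 2 m).image i

/-- `f : B → P` is bad: `¬ r (f b₁) (f b₂)` whenever `b₁ ◁ b₂` in `B`. -/
def IsBadOn {P : Type*} (r : P → P → Prop) (B : Set (Finset ℕ)) (f : Finset ℕ → P) : Prop :=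
  ∀ b₁ ∈ B, ∀ b₂ ∈ B, BarrierPrec b₁ b₂ → ¬ r (f b₁) (f b₂)

/-- `r` is a bqo on `S`: every function from a barrier into `S` is good. -/
def IsBqoOn {P : Type*} (r : P → P → Prop) (S : Set P) : Prop :=
  ∀ B : Set (Finset ℕ), IsBarrier B → ∀ f : Finset ℕ → P,
    (∀ b ∈ B, f b ∈ S) → ¬ IsBadOn r B f

/-- `r` is a bqo: every function from a barrier into `P` is good. -/
def IsBqo {P : Type*} (r : P → P → Prop) : Prop :=
  ∀ B : Set (Finset ℕ), IsBarrier B → ∀ f : Finset ℕ → P, ¬ IsBadOn r B f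

universe u

namespace BadArray

/-- The members of `A` that lie above every member of `s`. -/
def above (s : Finset ℕ) (A : Set ℕ) : Set ℕ := {a ∈ A | ∀ i ∈ s, i < a}

theorem above_subset (s : Finset ℕ) (A : Set ℕ) : above s A ⊆ A := fun _ h => h.1

theorem infinite_inter_Ici {A : Set ℕ} (hA : A.Infinite) (n : ℕ) : (A ∩ Ici n).Infinite := by
  have h : A ∩ Ici n = A \ Iio n := by ext; simp
  rw [h]
  exact hA.sdiff (finite_Iio n)

theorem infinite_above {A : Set ℕ} (hA : A.Infinite) (s : Finset ℕ) : (above s A).Infinite := by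
  refine (infinite_inter_Ici hA (s.sup id + 1)).mono fun a ha => ⟨ha.1, fun i hi => ?_⟩
  have h1 : i ≤ s.sup id := Finset.le_sup (f := id) hi
  have h2 := ha.2
  simp only [mem_Ici] at h2
  omega

theorem sInf_mem_of_infinite {A : Set ℕ} (hA : A.Infinite) : sInf A ∈ A := Nat.sInf_mem hA.nonempty

/-- Diagonalization: a hereditary property of pairs `(s, A)` that can always be achieved by
shrinking `A` holds simultaneously for all finite subsets of some infinite set. -/
theorem exists_fusion (D : Finset ℕ → Set ℕ → Prop) {A₀ : Set ℕ} (hA₀ : A₀.Infinite)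
    (her : ∀ s A A', A' ⊆ A → D s A → D s A')
    (dense : ∀ s : Finset ℕ, ↑s ⊆ A₀ → ∀ A ⊆ A₀, A.Infinite → ∃ A' ⊆ A, A'.Infinite ∧ D s A') :
    ∃ A ⊆ A₀, A.Infinite ∧ ∀ s : Finset ℕ, ↑s ⊆ A → D s (above s A) := by
  have dense_finset : ∀ F : Finset (Finset ℕ), ∀ A ⊆ A₀, A.Infinite →
      ∃ A' ⊆ A, A'.Infinite ∧ ∀ s ∈ F, ↑s ⊆ A₀ → D s A' := by
    intro F
    induction F using Finset.induction_on with
    | empty => exact fun A _ hA => ⟨A, Subset.rfl, hA, by simp⟩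
    | insert t F _ ih =>
      intro A hAA hA
      obtain ⟨A', h1, h2, h3⟩ := ih A hAA hA
      by_cases ht : (t : Set ℕ) ⊆ A₀
      · obtain ⟨A'', h4, h5, h6⟩ := dense t ht A' (h1.trans hAA) h2
        refine ⟨A'', h4.trans h1, h5, fun s hs hsA => ?_⟩
        rcases Finset.mem_insert.1 hs with rfl | hs
        · exact h6
        · exact her _ _ _ h4 (h3 s hs hsA)
      · refine ⟨A', h1, h2, fun s hs hsA => ?_⟩
        rcases Finset.mem_insert.1 hs with rfl | hs
        · exact absurd hsA ht
        · exact h3 s hs hsA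
  have step : ∀ A : {A : Set ℕ // A ⊆ A₀ ∧ A.Infinite}, ∃ A' : {A : Set ℕ // A ⊆ A₀ ∧ A.Infinite},
      A'.1 ⊆ A.1 ∩ Ioi (sInf A.1) ∧
      ∀ s ∈ (Finset.range (sInf A.1 + 1)).powerset, ↑s ⊆ A₀ → D s A'.1 := by
    rintro ⟨A, hAA, hA⟩
    have h : (A ∩ Ioi (sInf A)).Infinite := infinite_inter_Ici hA (sInf A + 1)
    obtain ⟨A', h1, h2, h3⟩ := dense_finset (Finset.range (sInf A + 1)).powerset _
      (inter_subset_left.trans hAA) h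
    exact ⟨⟨A', h1.trans (inter_subset_left.trans hAA), h2⟩, h1, h3⟩
  choose next hnext1 hnext2 using step
  obtain ⟨A₁, hA₁, hA₁i, hA₁D⟩ := dense ∅ (by simp) A₀ Subset.rfl hA₀
  let S : ℕ → {A : Set ℕ // A ⊆ A₀ ∧ A.Infinite} := fun k => Nat.rec ⟨A₁, hA₁, hA₁i⟩ (fun _ => next) k
  have hS : ∀ k, S (k + 1) = next (S k) := fun k => rfl
  let a : ℕ → ℕ := fun k => sInf (S k).1
  have ha : ∀ k, a k ∈ (S k).1 := fun k => sInf_mem_of_infinite (S k).2.2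
  have hanti : Antitone fun k => (S k).1 :=
    antitone_nat_of_succ_le fun k => by
      rw [hS]; exact (hnext1 (S k)).trans inter_subset_left
  have hmono : StrictMono a := strictMono_nat_of_lt_succ fun k => by
    have h := ha (k + 1)
    rw [hS] at h
    exact (hnext1 (S k) h).2
  refine ⟨range a, ?_, infinite_range_of_injective hmono.injective, fun s hs => ?_⟩
  · rintro _ ⟨k, rfl⟩
    exact (S k).2.1 (ha k)
  · rcases s.eq_empty_or_nonempty with rfl | hne
    · refine her _ A₁ _ ?_ hA₁D
      rintro _ ⟨⟨k, rfl⟩, -⟩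
      exact hanti (Nat.zero_le k) (ha k)
    · obtain ⟨k, hk⟩ := hs (s.max'_mem hne)
      refine her _ (S (k + 1)).1 _ ?_ ?_
      · rintro _ ⟨⟨j, rfl⟩, hj⟩
        have h := hj _ (s.max'_mem hne)
        rw [← hk] at h
        exact hanti (hmono.lt_iff_lt.1 h) (ha j)
      · rw [hS]
        refine hnext2 (S k) s ?_ ?_
        · rw [Finset.mem_powerset]
          intro i hi
          have h := s.le_max' i hi
          rw [← hk] at h
          exact Finset.mem_range.2 (Nat.lt_succ_of_le h)
        · intro i hi
          obtain ⟨j, rfl⟩ := hs hi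
          exact (S j).2.1 (ha j)

/-- `U` is open as a family of infinite subsets of `A`. -/
def OpenIn (A : Set ℕ) (U : Set ℕ → Prop) : Prop :=
  ∀ X ⊆ A, X.Infinite → U X → ∃ n, ∀ Y ⊆ A, Y.Infinite → Y ∩ Iio n = X ∩ Iio n → U Y

/-- Open families of infinite sets of natural numbers are Ramsey. -/
theorem exists_homogeneous {U : Set ℕ → Prop} {A₀ : Set ℕ} (hA₀ : A₀.Infinite)
    (hU : OpenIn A₀ U) :
    ∃ A ⊆ A₀, A.Infinite ∧
      ((∀ X ⊆ A, X.Infinite → U X) ∨ ∀ X ⊆ A, X.Infinite → ¬ U X) := by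
  let acc : Finset ℕ → Set ℕ → Prop := fun s A =>
    ∀ Y ⊆ A, Y.Infinite → (∀ i ∈ s, ∀ j ∈ Y, i < j) → U (↑s ∪ Y)
  let rej : Finset ℕ → Set ℕ → Prop := fun s A => ∀ A' ⊆ A, A'.Infinite → ¬ acc s A'
  obtain ⟨A₁, hA₁, hA₁i, hdec⟩ := exists_fusion (fun s A => acc s A ∨ rej s A) hA₀
    (by
      rintro s A A' h (h1 | h1)
      · exact Or.inl fun Y hY => h1 Y (hY.trans h)
      · exact Or.inr fun Y hY => h1 Y (hY.trans h))
    (by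
      intro s _ A _ hA
      by_cases h : ∃ A' ⊆ A, A'.Infinite ∧ acc s A'
      · obtain ⟨A', h1, h2, h3⟩ := h
        exact ⟨A', h1, h2, Or.inl h3⟩
      · exact ⟨A, Subset.rfl, hA, Or.inr fun A' h1 h2 h3 => h ⟨A', h1, h2, h3⟩⟩)
  have hdec' : ∀ s : Finset ℕ, ↑s ⊆ A₁ → acc s A₁ ∨ rej s A₁ := by
    intro s hs
    rcases hdec s hs with h | h
    · exact Or.inl fun Y hY hYi hsY => h Y (fun y hy => ⟨hY hy, fun i hi => hsY i hi y hy⟩) hYi hsY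
    · refine Or.inr fun A' hA' hA'i hacc => h (above s A') (fun y hy => ⟨hA' hy.1, hy.2⟩)
        (infinite_above hA'i s) fun Y hY => hacc Y (hY.trans (above_subset s A'))
  rcases hdec' ∅ (by simp) with hacc | hrej
  · refine ⟨A₁, hA₁, hA₁i, Or.inl fun X hX hXi => ?_⟩
    simpa using hacc X hX hXi (by simp)
  obtain ⟨A₂, hA₂, hA₂i, hD⟩ := exists_fusion
    (fun s A => rej s A₁ → ∀ n ∈ A, (∀ i ∈ s, i < n) → rej (insert n s) A₁) hA₁i
    (fun s A A' h h1 hr n hn => h1 hr n (h hn))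
    (by
      intro s hs A hAA hA
      by_cases hr : rej s A₁
      · have hfin : {n ∈ A | (∀ i ∈ s, i < n) ∧ acc (insert n s) A₁}.Finite := by
          by_contra hinf
          refine hr _ (fun n hn => hAA hn.1) hinf fun Y hY hYi hsY => ?_
          have hmin := sInf_mem_of_infinite hYi
          have h := (hY hmin).2.2 (Y \ {sInf Y}) (fun y hy => hAA (hY hy.1).1)
            (hYi.sdiff (finite_singleton _)) (by
              intro i hi j hj
              rcases Finset.mem_insert.1 hi with rfl | hi
              · exact lt_of_le_of_ne (Nat.sInf_le hj.1) fun h => hj.2 h.symm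
              · exact hsY i hi j hj.1)
          convert h using 1
          ext j
          by_cases hj : j = sInf Y <;> simp [hj, hmin]
        refine ⟨_, sdiff_subset, hA.sdiff hfin, fun _ n hn hsn => ?_⟩
        refine (hdec' (insert n s) ?_).resolve_left fun h => hn.2 ⟨hn.1, hsn, h⟩
        rw [Finset.coe_insert]
        exact insert_subset (hAA hn.1) hs
      · exact ⟨A, Subset.rfl, hA, fun h => absurd h hr⟩)
  have hrej' : ∀ s : Finset ℕ, ↑s ⊆ A₂ → rej s A₁ := by
    intro s
    induction s using Finset.induction_on_max with
    | empty => exact fun _ => hrej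
    | insert n s hn ih =>
      intro hs
      rw [Finset.coe_insert, insert_subset_iff] at hs
      exact hD s hs.2 (ih hs.2) n ⟨hs.1, hn⟩ hn
  refine ⟨A₂, hA₂.trans hA₁, hA₂i, Or.inr fun X hX hXi hUX => ?_⟩
  obtain ⟨n, hn⟩ := hU X (hX.trans (hA₂.trans hA₁)) hXi hUX
  have hfin : (X ∩ Iio n).Finite := (finite_Iio n).inter_of_right X
  have hco : (hfin.toFinset : Set ℕ) = X ∩ Iio n := hfin.coe_toFinset
  refine hrej' hfin.toFinset (by rw [hco]; exact inter_subset_left.trans hX) (A₂ ∩ Ici n)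
    (inter_subset_left.trans hA₂) (infinite_inter_Ici hA₂i n) fun Y hY hYi _ => ?_
  rw [hco]
  refine hn _ (union_subset (inter_subset_left.trans (hX.trans (hA₂.trans hA₁)))
    (hY.trans (inter_subset_left.trans (hA₂.trans hA₁)))) (hYi.mono subset_union_right) ?_
  ext j
  have : j ∈ Y → n ≤ j := fun hj => (hY hj).2
  simp only [mem_inter_iff, mem_union, mem_Iio]
  constructor
  · rintro ⟨h | h, h'⟩
    · exact h
    · exact absurd (this h) (by omega)
  · exact fun h => ⟨Or.inl h, h.2⟩

theorem exists_inter_Iio_eq {X : Set ℕ} (hX : X.Infinite) (m : ℕ) :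
    ∃ n > m, ∃ s : Finset ℕ, ↑s = X ∩ Iio n ∧ m ≤ s.sup id := by
  obtain ⟨a, haX, ham⟩ := hX.exists_gt m
  have hfin : (X ∩ Iio (a + 1)).Finite := (finite_Iio _).inter_of_right X
  have hco : (hfin.toFinset : Set ℕ) = X ∩ Iio (a + 1) := hfin.coe_toFinset
  have has : a ∈ hfin.toFinset := by simp [haX]
  refine ⟨a + 1, by omega, hfin.toFinset, hco,
    ham.le.trans (Finset.le_sup (f := id) has)⟩

/-- `X` without its least element. -/
noncomputable def dropMin (X : Set ℕ) : Set ℕ := X \ {sInf X}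

theorem dropMin_subset (X : Set ℕ) : dropMin X ⊆ X := sdiff_subset

theorem dropMin_infinite {X : Set ℕ} (hX : X.Infinite) : (dropMin X).Infinite :=
  hX.sdiff (finite_singleton _)

theorem dropMin_inter_Iio {X Y : Set ℕ} {n : ℕ} (hX : X.Infinite) (hY : Y.Infinite)
    (hn : sInf X < n) (h : Y ∩ Iio n = X ∩ Iio n) :
    sInf Y = sInf X ∧ dropMin Y ∩ Iio n = dropMin X ∩ Iio n := by
  have hXm := sInf_mem_of_infinite hX
  have hYm := sInf_mem_of_infinite hY
  have h1 : sInf X ∈ Y := ((Set.ext_iff.1 h (sInf X)).2 ⟨hXm, hn⟩).1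
  have h2 : sInf Y ≤ sInf X := Nat.sInf_le h1
  have h3 : sInf Y ∈ X := ((Set.ext_iff.1 h (sInf Y)).1 ⟨hYm, lt_of_le_of_lt h2 hn⟩).1
  have h4 : sInf Y = sInf X := le_antisymm h2 (Nat.sInf_le h3)
  refine ⟨h4, ?_⟩
  ext j
  have := Set.ext_iff.1 h j
  simp only [dropMin, h4, mem_inter_iff, Set.mem_sdiff, mem_singleton_iff] at this ⊢
  tauto

section

variable {P : Type*}

/-- On infinite subsets of `A`, the value of `f` depends only on a finite part of its argument. -/
def LocConst (A : Set ℕ) (f : Set ℕ → P) : Prop :=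
  ∀ X ⊆ A, X.Infinite → ∃ n, ∀ Y ⊆ A, Y.Infinite → Y ∩ Iio n = X ∩ Iio n → f Y = f X

theorem LocConst.mono {A A' : Set ℕ} {f : Set ℕ → P} (h : LocConst A f) (hA : A' ⊆ A) :
    LocConst A' f := fun X hX hXi =>
  (h X (hX.trans hA) hXi).imp fun _ hn Y hY => hn Y (hY.trans hA)

theorem inter_Iio_eq_of_le {X Y : Set ℕ} {m n : ℕ} (hmn : m ≤ n) (h : Y ∩ Iio n = X ∩ Iio n) :
    Y ∩ Iio m = X ∩ Iio m := by
  ext j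
  have := Set.ext_iff.1 h j
  simp only [mem_inter_iff, mem_Iio] at this ⊢
  constructor <;> intro hj <;> refine ⟨?_, hj.2⟩
  · exact (this.1 ⟨hj.1, by omega⟩).1
  · exact (this.2 ⟨hj.1, by omega⟩).1

theorem LocConst.comp_dropMin {A : Set ℕ} {f : Set ℕ → P} (h : LocConst A f) :
    LocConst A fun X => f (dropMin X) := by
  intro X hX hXi
  obtain ⟨n, hn⟩ := h (dropMin X) ((dropMin_subset X).trans hX) (dropMin_infinite hXi)
  refine ⟨max n (sInf X + 1), fun Y hY hYi hYX => hn _ ((dropMin_subset Y).trans hY)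
    (dropMin_infinite hYi) ?_⟩
  have hle : n ≤ max n (sInf X + 1) := le_max_left _ _
  exact inter_Iio_eq_of_le hle (dropMin_inter_Iio hXi hYi (by omega) hYX).2

theorem LocConst.map₂ {P' R : Type*} {A : Set ℕ} {f : Set ℕ → P} {g : Set ℕ → P'}
    (hf : LocConst A f) (hg : LocConst A g) (φ : P → P' → R) :
    LocConst A fun X => φ (f X) (g X) := by
  intro X hX hXi
  obtain ⟨m, hm⟩ := hf X hX hXi
  obtain ⟨n, hn⟩ := hg X hX hXi
  refine ⟨max m n, fun Y hY hYi h => ?_⟩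
  simp only
  rw [hm Y hY hYi (inter_Iio_eq_of_le (le_max_left _ _) h),
    hn Y hY hYi (inter_Iio_eq_of_le (le_max_right _ _) h)]

theorem LocConst.openIn {A : Set ℕ} {f : Set ℕ → Prop} (h : LocConst A f) : OpenIn A f :=
  fun X hX hXi hf => by
    obtain ⟨n, hn⟩ := h X hX hXi
    exact ⟨n, fun Y hY hYi hYX => by rw [hn Y hY hYi hYX]; exact hf⟩

/-- A pointwise eventually constant limit of locally constant functions is locally constant
after shrinking the domain. -/
theorem exists_locConst_limit {A : Set ℕ} (hA : A.Infinite) {f : ℕ → Set ℕ → P} {F : Set ℕ → P}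
    (hf : ∀ k, LocConst A (f k)) (hF : ∀ X ⊆ A, X.Infinite → ∃ k, ∀ j ≥ k, f j X = F X) :
    ∃ A' ⊆ A, A'.Infinite ∧ LocConst A' F := by
  let E : ℕ → Set ℕ → Prop := fun k X => ∃ j ≥ k, f j X ≠ f k X
  have hEmono : ∀ k l X, k ≤ l → ¬ E k X → ¬ E l X := by
    rintro k l X hkl h ⟨j, hj, hne⟩
    have h1 : f j X = f k X := by
      by_contra h'
      exact h ⟨j, hkl.trans hj, h'⟩
    have h2 : f l X = f k X := by
      by_contra h'
      exact h ⟨l, hkl, h'⟩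
    exact hne (h1.trans h2.symm)
  have hElim : ∀ k, ∀ X ⊆ A, X.Infinite → ¬ E k X → F X = f k X := by
    intro k X hX hXi h
    obtain ⟨l, hl⟩ := hF X hX hXi
    rw [← hl (max k l) (le_max_right _ _)]
    by_contra h'
    exact h ⟨_, le_max_left _ _, h'⟩
  obtain ⟨A', hA', hA'i, hD⟩ := exists_fusion
    (fun s B => (∀ Y ⊆ B, Y.Infinite → (∀ i ∈ s, ∀ j ∈ Y, i < j) → E (s.sup id) (↑s ∪ Y)) ∨
      ∀ Y ⊆ B, Y.Infinite → (∀ i ∈ s, ∀ j ∈ Y, i < j) → ¬ E (s.sup id) (↑s ∪ Y)) hA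
    (fun s B B' hB h => h.imp (fun h Y hY => h Y (hY.trans hB)) fun h Y hY => h Y (hY.trans hB))
    (by
      intro s hs B hBA hB
      obtain ⟨B', hB', hB'i, h⟩ := exists_homogeneous (U := fun Y => E (s.sup id) (↑s ∪ Y)) hB (by
        rintro Y hY hYi ⟨j, hj, hne⟩
        have hsub : ∀ Z ⊆ B, ↑s ∪ Z ⊆ A := fun Z hZ => union_subset hs (hZ.trans hBA)
        obtain ⟨n, hn⟩ := hf j _ (hsub Y hY) (hYi.mono subset_union_right)
        obtain ⟨m, hm⟩ := hf (s.sup id) _ (hsub Y hY) (hYi.mono subset_union_right)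
        refine ⟨max n m, fun Z hZ hZi hZY => ⟨j, hj, ?_⟩⟩
        have heq : (↑s ∪ Z) ∩ Iio (max n m) = (↑s ∪ Y) ∩ Iio (max n m) := by
          rw [union_inter_distrib_right, hZY, ← union_inter_distrib_right]
        rw [hn _ (hsub Z hZ) (hZi.mono subset_union_right)
          (inter_Iio_eq_of_le (le_max_left _ _) heq),
          hm _ (hsub Z hZ) (hZi.mono subset_union_right)
          (inter_Iio_eq_of_le (le_max_right _ _) heq)]
        exact hne)
      exact ⟨B', hB', hB'i, h.imp (fun h Y hY hYi _ => h Y hY hYi) fun h Y hY hYi _ => h Y hY hYi⟩)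
  refine ⟨A', hA', hA'i, fun X hX hXi => ?_⟩
  obtain ⟨m, hm⟩ := hF X (hX.trans hA') hXi
  have hEm : ¬ E m X := by
    rintro ⟨j, hj, hne⟩
    exact hne ((hm j hj).trans (hm m le_rfl).symm)
  obtain ⟨n, -, s, hs, hms⟩ := exists_inter_Iio_eq hXi m
  have hsplit : ∀ Z : Set ℕ, Z ⊆ A' → Z.Infinite → Z ∩ Iio n = X ∩ Iio n →
      (↑s ∪ (Z ∩ Ici n) = Z ∧ Z ∩ Ici n ⊆ above s A' ∧ (Z ∩ Ici n).Infinite ∧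
        ∀ i ∈ s, ∀ j ∈ Z ∩ Ici n, i < j) := by
    intro Z hZ hZi hZX
    have h1 : ∀ i ∈ s, ∀ j ∈ Z ∩ Ici n, i < j := by
      intro i hi j hj
      have h2 : i ∈ X ∩ Iio n := hs ▸ hi
      exact lt_of_lt_of_le h2.2 hj.2
    refine ⟨?_, fun j hj => ⟨hZ hj.1, fun i hi => h1 i hi j hj⟩, infinite_inter_Ici hZi n, h1⟩
    rw [hs, ← hZX, ← inter_union_distrib_left, Iio_union_Ici, inter_univ]
  have hnE : ∀ Y ⊆ above s A', Y.Infinite → (∀ i ∈ s, ∀ j ∈ Y, i < j) →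
      ¬ E (s.sup id) (↑s ∪ Y) := by
    refine (hD s ?_).resolve_left fun h => ?_
    · rw [hs]; exact inter_subset_left.trans hX
    · obtain ⟨h1, h2, h3, h4⟩ := hsplit X hX hXi rfl
      have h5 := h _ h2 h3 h4
      rw [h1] at h5
      exact hEmono _ _ _ hms hEm h5
  obtain ⟨l, hl⟩ := hf (s.sup id) X (hX.trans hA') hXi
  have hval : ∀ Z : Set ℕ, Z ⊆ A' → Z.Infinite → Z ∩ Iio n = X ∩ Iio n →
      F Z = f (s.sup id) Z := by
    intro Z hZ hZi hZX
    obtain ⟨h1, h2, h3, h4⟩ := hsplit Z hZ hZi hZX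
    have h5 := hnE _ h2 h3 h4
    rw [h1] at h5
    exact hElim _ Z (hZ.trans hA') hZi h5
  refine ⟨max n l, fun Y hY hYi hYX => ?_⟩
  rw [hval Y hY hYi (inter_Iio_eq_of_le (le_max_left _ _) hYX), hval X hX hXi rfl,
    hl Y (hY.trans hA') hYi (inter_Iio_eq_of_le (le_max_right _ _) hYX)]

end

section

variable {P : Type*} (r : P → P → Prop) (rk : P → Ordinal.{u})

/-- `f` is a locally constant bad array, for the relation `r`, on the infinite subsets of `A`. -/
structure IsBad (A : Set ℕ) (f : Set ℕ → P) : Prop where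
  infinite : A.Infinite
  bad : ∀ X ⊆ A, X.Infinite → ¬ r (f X) (f (dropMin X))
  locConst : LocConst A f

/-- The partial ranking given by `r` and strict decrease of `rk`. -/
def Below (a b : P) : Prop := rk a < rk b ∧ r a b

/-- The reflexive closure of `Below`. -/
def BelowEq (a b : P) : Prop := a = b ∨ Below r rk a b

variable {r rk}

theorem BelowEq.rank_le {a b : P} (h : BelowEq r rk a b) : rk a ≤ rk b := by
  rcases h with rfl | h
  · exact le_rfl
  · exact h.1.le

theorem BelowEq.eq_of_rank_le {a b : P} (h : BelowEq r rk a b) (h' : rk b ≤ rk a) : a = b :=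
  h.resolve_right fun h => h.1.not_ge h'

theorem BelowEq.trans [IsTrans P r] {a b c : P} (h : BelowEq r rk a b) (h' : BelowEq r rk b c) :
    BelowEq r rk a c := by
  rcases h with rfl | h
  · exact h'
  · rcases h' with rfl | h'
    · exact Or.inr h
    · exact Or.inr ⟨h.1.trans h'.1, _root_.trans h.2 h'.2⟩

variable (r rk)

/-- `c'` is a restriction of `c` with values decreased, whose domain agrees with that of `c`
below `n`. -/
def Refines (n : ℕ) (c' c : Set ℕ × (Set ℕ → P)) : Prop :=
  c'.1 ⊆ c.1 ∧ c'.1 ∩ Iio n = c.1 ∩ Iio n ∧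
    ∀ X ⊆ c'.1, X.Infinite → BelowEq r rk (c'.2 X) (c.2 X)

/-- The array `c` is constant on the infinite sets whose part below `n` is `s`. -/
def Decided (n : ℕ) (s : Set ℕ) (c : Set ℕ × (Set ℕ → P)) : Prop :=
  ∀ X ⊆ c.1, X.Infinite → X ∩ Iio n = s → ∀ Y ⊆ c.1, Y.Infinite → Y ∩ Iio n = s → c.2 X = c.2 Y

/-- No bad refinement of `c` that is constant on the infinite sets whose part below `n` is `s`
takes a smaller value there. -/
def Frozen (n : ℕ) (s : Set ℕ) (c : Set ℕ × (Set ℕ → P)) : Prop :=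
  ∀ c' : Set ℕ × (Set ℕ → P), IsBad r c'.1 c'.2 → Refines r rk n c' c → Decided n s c' →
    ∀ X ⊆ c'.1, X.Infinite → X ∩ Iio n = s → c'.2 X = c.2 X

variable {r rk}

theorem Refines.refl (n : ℕ) (c : Set ℕ × (Set ℕ → P)) : Refines r rk n c c :=
  ⟨Subset.rfl, rfl, fun _ _ _ => Or.inl rfl⟩

theorem Refines.trans [IsTrans P r] {n : ℕ} {c c' c'' : Set ℕ × (Set ℕ → P)}
    (h : Refines r rk n c'' c') (h' : Refines r rk n c' c) : Refines r rk n c'' c :=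
  ⟨h.1.trans h'.1, h.2.1.trans h'.2.1,
    fun X hX hXi => (h.2.2 X hX hXi).trans (h'.2.2 X (hX.trans h.1) hXi)⟩

theorem Refines.mono {m n : ℕ} (hmn : m ≤ n) {c c' : Set ℕ × (Set ℕ → P)}
    (h : Refines r rk n c' c) : Refines r rk m c' c :=
  ⟨h.1, inter_Iio_eq_of_le hmn h.2.1, h.2.2⟩

theorem Frozen.refines [IsTrans P r] {n : ℕ} {s : Set ℕ} {c c' : Set ℕ × (Set ℕ → P)}
    (hc : Frozen r rk n s c) (h : Refines r rk n c' c) : Frozen r rk n s c' := by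
  intro d hd hdc hdd X hX hXi hXs
  have h1 := hc d hd (hdc.trans h) hdd X hX hXi hXs
  refine (hdc.2.2 X hX hXi).eq_of_rank_le ?_
  rw [h1]
  exact (h.2.2 X (hX.trans hdc.1) hXi).rank_le

theorem exists_frozen [IsTrans P r] (n : ℕ) (s : Set ℕ) {c : Set ℕ × (Set ℕ → P)}
    (hc : IsBad r c.1 c.2) :
    ∃ c' : Set ℕ × (Set ℕ → P), IsBad r c'.1 c'.2 ∧ Refines r rk n c' c ∧ Frozen r rk n s c' := by
  let O : Set Ordinal.{u} := {o | ∃ c' : Set ℕ × (Set ℕ → P), IsBad r c'.1 c'.2 ∧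
    Refines r rk n c' c ∧ Decided n s c' ∧
      ∃ X ⊆ c'.1, X.Infinite ∧ X ∩ Iio n = s ∧ rk (c'.2 X) = o}
  by_cases hO : O.Nonempty
  · obtain ⟨c', h1, h2, h3, X, hX, hXi, hXs, ho⟩ := csInf_mem hO
    refine ⟨c', h1, h2, fun d hd hdc hdd Y hY hYi hYs => ?_⟩
    refine (hdc.2.2 Y hY hYi).eq_of_rank_le ?_
    rw [h3 Y (hY.trans hdc.1) hYi hYs X hX hXi hXs, ho]
    exact csInf_le' ⟨d, hd, hdc.trans h2, hdd, Y, hY, hYi, hYs, rfl⟩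
  · refine ⟨c, hc, Refines.refl n c, fun d hd hdc hdd Y hY hYi hYs => ?_⟩
    exact absurd ⟨_, d, hd, hdc, hdd, Y, hY, hYi, hYs, rfl⟩ hO

theorem exists_frozen_forall [IsTrans P r] (n : ℕ) {c : Set ℕ × (Set ℕ → P)}
    (hc : IsBad r c.1 c.2) :
    ∃ c' : Set ℕ × (Set ℕ → P), IsBad r c'.1 c'.2 ∧ Refines r rk n c' c ∧
      ∀ s ⊆ Iio n, Frozen r rk n s c' := by
  suffices h : ∀ F : Set (Set ℕ), F.Finite → ∃ c' : Set ℕ × (Set ℕ → P), IsBad r c'.1 c'.2 ∧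
      Refines r rk n c' c ∧ ∀ s ∈ F, Frozen r rk n s c' from
    h (𝒫 (Iio n)) (finite_Iio n).powerset
  intro F hF
  induction F, hF using Set.Finite.induction_on with
  | empty => exact ⟨c, hc, Refines.refl n c, by simp⟩
  | insert _ _ ih =>
    obtain ⟨c', h1, h2, h3⟩ := ih
    obtain ⟨c'', h4, h5, h6⟩ := exists_frozen n _ h1
    refine ⟨c'', h4, h5.trans h2, fun s hs => ?_⟩
    rcases hs with rfl | hs
    · exact h6
    · exact (h3 s hs).refines h5

/-- Below every bad array there is a minimal one, with respect to the partial ranking `Below`. -/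
theorem exists_minimal_isBad [IsTrans P r] {A₀ : Set ℕ} {f₀ : Set ℕ → P} (h₀ : IsBad r A₀ f₀) :
    ∃ A f, IsBad r A f ∧ ∀ A' ⊆ A, ∀ g, IsBad r A' g →
      ¬ ∀ X ⊆ A', X.Infinite → Below r rk (g X) (f X) := by
  let St := {c : (Set ℕ × (Set ℕ → P)) × ℕ // IsBad r c.1.1 c.1.2}
  have step : ∀ c : St, ∃ c' : St, Refines r rk c.1.2 c'.1.1 c.1.1 ∧
      (∀ s ⊆ Iio c.1.2, Frozen r rk c.1.2 s c'.1.1) ∧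
      c'.1.2 = sInf (c'.1.1.1 ∩ Ici c.1.2) + 1 := by
    rintro ⟨⟨c, n⟩, hc⟩
    obtain ⟨c', h1, h2, h3⟩ := exists_frozen_forall (rk := rk) n hc
    exact ⟨⟨(c', sInf (c'.1 ∩ Ici n) + 1), h1⟩, h2, h3, rfl⟩
  choose next hnext1 hnext2 hnext3 using step
  let S : ℕ → St := fun k => Nat.rec ⟨((A₀, f₀), 0), h₀⟩ (fun _ => next) k
  have hS : ∀ k, S (k + 1) = next (S k) := fun k => rfl
  let A : ℕ → Set ℕ := fun k => (S k).1.1.1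
  let f : ℕ → Set ℕ → P := fun k => (S k).1.1.2
  let N : ℕ → ℕ := fun k => (S k).1.2
  have hbad : ∀ k, IsBad r (A k) (f k) := fun k => (S k).2
  have href1 : ∀ k, Refines r rk (N k) (S (k + 1)).1.1 (S k).1.1 := fun k => hnext1 (S k)
  have hfroz : ∀ k, ∀ s ⊆ Iio (N k), Frozen r rk (N k) s (S (k + 1)).1.1 := fun k => hnext2 (S k)
  have hmem : ∀ k, ∃ m ∈ A (k + 1), N k ≤ m ∧ N (k + 1) = m + 1 := fun k => by
    have h := sInf_mem_of_infinite (infinite_inter_Ici (hbad (k + 1)).infinite (N k))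
    exact ⟨_, h.1, h.2, hnext3 (S k)⟩
  have hNmono : StrictMono N := strictMono_nat_of_lt_succ fun k => by
    obtain ⟨m, -, h1, h2⟩ := hmem k
    omega
  have href : ∀ k j, k ≤ j → Refines r rk (N k) (S j).1.1 (S k).1.1 := by
    intro k j hkj
    induction j, hkj using Nat.le_induction with
    | base => exact Refines.refl _ _
    | succ j hkj ih => exact ((href1 j).mono (hNmono.monotone hkj)).trans ih
  let A' : Set ℕ := ⋂ k, A k
  have hA'sub : ∀ k, A' ⊆ A k := fun k => iInter_subset _ k
  have hA'N : ∀ k, A k ∩ Iio (N k) ⊆ A' := by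
    intro k x hx
    refine mem_iInter.2 fun j => ?_
    rcases le_total k j with hkj | hkj
    · have h := (href k j hkj).2.1
      exact ((Set.ext_iff.1 h x).2 hx).1
    · exact (href j k hkj).1 hx.1
  have hA'i : A'.Infinite := by
    refine infinite_of_forall_exists_gt fun k => ?_
    obtain ⟨m, h1, h2, h3⟩ := hmem (k + 1)
    exact ⟨m, hA'N (k + 2) ⟨h1, by simp [h3]⟩, hNmono.le_apply.trans h2⟩
  have hle : ∀ X ⊆ A', X.Infinite → ∀ k j, k ≤ j → BelowEq r rk (f j X) (f k X) :=
    fun X hX hXi k j hkj => (href k j hkj).2.2 X (hX.trans (hA'sub j)) hXi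
  have hlim : ∀ X, ∃ p, X ⊆ A' → X.Infinite → ∃ k, ∀ j ≥ k, f j X = p := by
    intro X
    obtain ⟨k, hk⟩ := csInf_mem (range_nonempty fun k => rk (f k X))
    refine ⟨f k X, fun hX hXi => ⟨k, fun j hj => (hle X hX hXi k j hj).eq_of_rank_le ?_⟩⟩
    simp only at hk
    rw [hk]
    exact csInf_le' ⟨j, rfl⟩
  choose F hF using hlim
  have hFle : ∀ X ⊆ A', X.Infinite → ∀ k, BelowEq r rk (F X) (f k X) := by
    intro X hX hXi k
    obtain ⟨l, hl⟩ := hF X hX hXi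
    rw [← hl (max k l) (le_max_right _ _)]
    exact hle X hX hXi _ _ (le_max_left _ _)
  have hFbad : ∀ X ⊆ A', X.Infinite → ¬ r (F X) (F (dropMin X)) := by
    intro X hX hXi
    obtain ⟨k, hk⟩ := hF X hX hXi
    obtain ⟨l, hl⟩ := hF _ ((dropMin_subset X).trans hX) (dropMin_infinite hXi)
    rw [← hk (max k l) (le_max_left _ _), ← hl (max k l) (le_max_right _ _)]
    exact (hbad _).bad X (hX.trans (hA'sub _)) hXi
  obtain ⟨B, hB, hBi, hBF⟩ := exists_locConst_limit hA'i
    (fun k => (hbad k).locConst.mono (hA'sub k)) hF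
  refine ⟨B, F, ⟨hBi, fun X hX => hFbad X (hX.trans hB), hBF⟩, fun C hC g hg hgF => ?_⟩
  have hCA' := hC.trans hB
  obtain ⟨n, hn⟩ := hg.locConst C Subset.rfl hg.infinite
  have hnN : n ≤ N n := hNmono.le_apply
  let A'' : Set ℕ := (A (n + 1) ∩ Iio (N n)) ∪ (C ∩ Ici (N n))
  have hA''sub : A'' ⊆ A (n + 1) :=
    union_subset inter_subset_left (inter_subset_left.trans (hCA'.trans (hA'sub (n + 1))))
  have hCA'' : C ⊆ A'' := fun x hx => by
    rcases lt_or_ge x (N n) with h | h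
    · exact Or.inl ⟨hA'sub (n + 1) (hCA' hx), h⟩
    · exact Or.inr ⟨hx, h⟩
  have hsub : ∀ X ⊆ A'', X ∩ Iio (N n) ⊆ C → X ⊆ C := by
    intro X hX h x hx
    rcases lt_or_ge x (N n) with h' | h'
    · exact h ⟨hx, h'⟩
    · exact ((hX hx).resolve_left fun h'' => absurd h''.2 (not_lt.2 h')).1
  classical
  let φ : Set ℕ → P := fun X => if X ⊆ C then g X else f (n + 1) X
  have hφle : ∀ X ⊆ A'', X.Infinite → BelowEq r rk (φ X) (f (n + 1) X) := by
    intro X hX hXi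
    by_cases h : X ⊆ C
    · simp only [φ, h, if_true]
      exact BelowEq.trans (Or.inr (hgF X h hXi)) (hFle X (h.trans hCA') hXi (n + 1))
    · simp only [φ, h, if_false]
      exact Or.inl rfl
  have hφbad : IsBad r A'' φ := by
    refine ⟨hg.infinite.mono hCA'', fun X hX hXi => ?_, fun X hX hXi => ?_⟩
    · by_cases h : X ⊆ C
      · have h' := (dropMin_subset X).trans h
        simp only [φ, h, h', if_true]
        exact hg.bad X h hXi
      · intro hr
        have h1 := (hbad (n + 1)).bad X (hX.trans hA''sub) hXi
        simp only [φ, h, if_false] at hr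
        rcases hφle _ ((dropMin_subset X).trans hX) (dropMin_infinite hXi) with h2 | h2
        · simp only [φ] at h2
          rw [h2] at hr
          exact h1 hr
        · exact h1 (_root_.trans hr h2.2)
    · by_cases h : X ⊆ C
      · obtain ⟨m, hm⟩ := hg.locConst X h hXi
        refine ⟨max m (N n), fun Y hY hYi hYX => ?_⟩
        have h' : Y ⊆ C := hsub Y hY <| by
          rw [inter_Iio_eq_of_le (le_max_right _ _) hYX]
          exact inter_subset_left.trans h
        simp only [φ, h, h', if_true]
        exact hm Y h' hYi (inter_Iio_eq_of_le (le_max_left _ _) hYX)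
      · obtain ⟨m, hm⟩ := (hbad (n + 1)).locConst X (hX.trans hA''sub) hXi
        refine ⟨max m (N n), fun Y hY hYi hYX => ?_⟩
        have h' : ¬ Y ⊆ C := fun h' => h <| hsub X hX <| by
          rw [← inter_Iio_eq_of_le (le_max_right _ _) hYX]
          exact inter_subset_left.trans h'
        simp only [φ, h, h', if_false]
        exact hm Y (hY.trans hA''sub) hYi (inter_Iio_eq_of_le (le_max_left _ _) hYX)
  have hφref : Refines r rk (N n) (A'', φ) (S (n + 1)).1.1 := by
    refine ⟨hA''sub, ?_, hφle⟩
    refine Subset.antisymm (inter_subset_inter_left _ hA''sub) fun x hx => ⟨Or.inl hx, hx.2⟩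
  have hφC : ∀ X ⊆ A'', X.Infinite → X ∩ Iio (N n) = C ∩ Iio (N n) → φ X = g C := by
    intro X hX hXi hXC
    have h : X ⊆ C := hsub X hX (hXC ▸ inter_subset_left)
    simp only [φ, h, if_true]
    exact hn X h hXi (inter_Iio_eq_of_le hnN hXC)
  have hdec : Decided (N n) (C ∩ Iio (N n)) (A'', φ) := fun X hX hXi hXC Y hY hYi hYC =>
    (hφC X hX hXi hXC).trans (hφC Y hY hYi hYC).symm
  have heq := hfroz n _ inter_subset_right _ hφbad hφref hdec C hCA'' hg.infinite rfl
  have h1 : φ C = g C := hφC C hCA'' hg.infinite rfl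
  have h2 := (hFle C hCA' hg.infinite (n + 1)).rank_le
  have h3 := (hgF C Subset.rfl hg.infinite).1
  have h4 : g C = f (n + 1) C := h1.symm.trans heq
  rw [h4] at h3
  exact h3.not_ge h2

end

theorem SExtends.subset {X : Set ℕ} {s : Finset ℕ} (h : SExtends X s) : ↑s ⊆ X := by
  rw [SExtends] at h
  rw [h]
  exact fun _ h => h.1

theorem SExtends.mem {X : Set ℕ} {s : Finset ℕ} (h : SExtends X s) {i m : ℕ} (hi : i ∈ X)
    (hm : m ∈ s) (him : i ≤ m) : i ∈ s := by
  have h' : i ∈ (s : Set ℕ) := by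
    rw [SExtends] at h
    rw [h]
    exact ⟨hi, m, hm, him⟩
  exact h'

theorem sExtends_iff {X : Set ℕ} {s : Finset ℕ} :
    SExtends X s ↔ ↑s ⊆ X ∧ ∀ i ∈ X, ∀ m ∈ s, i ≤ m → i ∈ s := by
  refine ⟨fun h => ⟨SExtends.subset h, fun i hi m hm => SExtends.mem h hi hm⟩, fun h => ?_⟩
  ext i
  exact ⟨fun hi => ⟨h.1 hi, i, hi, le_rfl⟩, fun ⟨hi, m, hm, him⟩ => h.2 i hi m hm him⟩

theorem SExtends.subset_or_subset {X : Set ℕ} {s t : Finset ℕ} (hs : SExtends X s)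
    (ht : SExtends X t) : s ⊆ t ∨ t ⊆ s := by
  by_contra! h
  obtain ⟨⟨i, hi, hit⟩, j, hj, hjs⟩ : (∃ i ∈ s, i ∉ t) ∧ ∃ j ∈ t, j ∉ s :=
    ⟨Finset.not_subset.1 h.1, Finset.not_subset.1 h.2⟩
  rcases le_total i j with hij | hij
  · exact hit (SExtends.mem ht (SExtends.subset hs hi) hj hij)
  · exact hjs (SExtends.mem hs (SExtends.subset ht hj) hi hij)

theorem SExtends.of_inter_Iio {X Y : Set ℕ} {s : Finset ℕ} (h : SExtends X s)
    (hYX : Y ∩ Iio (s.sup id + 1) = X ∩ Iio (s.sup id + 1)) : SExtends Y s := by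
  have hlt : ∀ {i m}, m ∈ s → i ≤ m → i < s.sup id + 1 := fun hm him =>
    Nat.lt_succ_of_le (him.trans (Finset.le_sup (f := id) hm))
  refine sExtends_iff.2 ⟨fun i hi => ?_, fun i hi m hm him => ?_⟩
  · exact ((Set.ext_iff.1 hYX i).2 ⟨SExtends.subset h hi, hlt hi le_rfl⟩).1
  · exact SExtends.mem h ((Set.ext_iff.1 hYX i).1 ⟨hi, hlt hm him⟩).1 hm him

theorem sExtends_union_above (s : Finset ℕ) (A : Set ℕ) : SExtends (↑s ∪ above s A) s := by
  refine sExtends_iff.2 ⟨subset_union_left, fun i hi m hm him => ?_⟩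
  rcases hi with hi | hi
  · exact hi
  · exact absurd (hi.2 m hm) (not_lt.2 him)

theorem SExtends.eq_image_nth {X : Set ℕ} (hX : X.Infinite) {s : Finset ℕ} (h : SExtends X s) :
    s = (Finset.range s.card).image (Nat.nth (· ∈ X)) := by
  have hX' : {i | i ∈ X}.Infinite := hX
  have h' : SExtends X ((Finset.range s.card).image (Nat.nth (· ∈ X))) := by
    refine sExtends_iff.2 ⟨fun i hi => ?_, fun i hi m hm him => ?_⟩
    · simp only [Finset.coe_image, mem_image] at hi
      obtain ⟨j, -, rfl⟩ := hi
      exact Nat.nth_mem_of_infinite hX' j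
    · classical
      simp only [Finset.mem_image, Finset.mem_range] at hm ⊢
      obtain ⟨j, hj, rfl⟩ := hm
      refine ⟨Nat.count (· ∈ X) i, ?_, Nat.nth_count hi⟩
      rw [← Nat.nth_count (p := (· ∈ X)) hi, Nat.nth_le_nth hX'] at him
      omega
  have hcard : ((Finset.range s.card).image (Nat.nth (· ∈ X))).card = s.card := by
    rw [Finset.card_image_of_injective _ (Nat.nth_injective hX'), Finset.card_range]
  rcases SExtends.subset_or_subset h h' with h1 | h1
  · exact Finset.eq_of_subset_of_card_le h1 hcard.le
  · exact (Finset.eq_of_subset_of_card_le h1 hcard.ge).symm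

theorem SExtends.insert_sInf {X : Set ℕ} (hX : X.Infinite) {s : Finset ℕ}
    (h : SExtends (dropMin X) s) : SExtends X (insert (sInf X) s) := by
  have hmin := sInf_mem_of_infinite hX
  refine sExtends_iff.2 ⟨?_, fun i hi m hm him => ?_⟩
  · rw [Finset.coe_insert]
    exact insert_subset hmin ((SExtends.subset h).trans (dropMin_subset X))
  · rw [Finset.mem_insert] at hm ⊢
    by_cases hi' : i = sInf X
    · exact Or.inl hi'
    · rcases hm with rfl | hm
      · exact Or.inl (le_antisymm him (Nat.sInf_le hi))
      · exact Or.inr (SExtends.mem h ⟨hi, hi'⟩ hm him)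

theorem barrierPrec_of_sExtends {X : Set ℕ} (hX : X.Infinite) {s t : Finset ℕ} (hs : SExtends X s)
    (ht : SExtends (dropMin X) t) (hne : s.Nonempty) (hts : s ≠ t → ¬ t ⊆ s) :
    BarrierPrec s t := by
  have hX' : {i | i ∈ X}.Infinite := hX
  have hins := SExtends.insert_sInf hX ht
  have hnot : sInf X ∉ t := fun h => (SExtends.subset ht h).2 rfl
  have hnsub : ¬ insert (sInf X) t ⊆ s := by
    intro h
    rw [Finset.insert_subset_iff] at h
    refine hts ?_ h.2
    rintro rfl
    exact hnot h.1
  have hsub : s ⊂ insert (sInf X) t :=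
    Finset.ssubset_iff_subset_ne.2 ⟨(SExtends.subset_or_subset hs hins).resolve_right hnsub,
      fun h => hnsub h.symm.subset⟩
  have hcard := Finset.card_lt_card hsub
  have hcard' : (insert (sInf X) t).card = t.card + 1 := Finset.card_insert_of_notMem hnot
  have hs' := SExtends.eq_image_nth hX hs
  have ht' := SExtends.eq_image_nth hX hins
  have hnth0 : Nat.nth (· ∈ X) 0 = sInf X := Nat.nth_zero
  refine ⟨t.card + 1, s.card, fun j => Nat.nth (· ∈ X) (j - 1), hne.card_pos, by omega, ?_, ?_, ?_⟩
  · intro a ha b _ hab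
    have := ha.1
    exact Nat.nth_strictMono hX' (by omega)
  · conv_lhs => rw [hs']
    ext x
    simp only [Finset.mem_image, Finset.mem_range, Finset.mem_Icc]
    constructor
    · rintro ⟨j, hj, rfl⟩
      exact ⟨j + 1, ⟨by omega, by omega⟩, by simp⟩
    · rintro ⟨j, hj, rfl⟩
      exact ⟨j - 1, by omega, rfl⟩
  · have h1 : t = (insert (sInf X) t).erase (sInf X) := (Finset.erase_insert hnot).symm
    rw [hcard'] at ht'
    conv_lhs => rw [h1, ht']
    ext x
    simp only [Finset.mem_erase, Finset.mem_image, Finset.mem_range, Finset.mem_Icc]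
    constructor
    · rintro ⟨hx, j, hj, rfl⟩
      have : j ≠ 0 := by rintro rfl; exact hx hnth0
      exact ⟨j + 1, ⟨by omega, by omega⟩, by simp⟩
    · rintro ⟨j, hj, rfl⟩
      refine ⟨fun h => ?_, j - 1, by omega, rfl⟩
      rw [← hnth0] at h
      have := Nat.nth_injective hX' h
      omega

theorem infinite_biUnion_of_infinite {B : Set (Finset ℕ)} (hB : B.Infinite) :
    (⋃ b ∈ B, (b : Set ℕ)).Infinite := by
  intro hfin
  refine hB ((hfin.toFinset.powerset.finite_toSet).subset fun b hb => ?_)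
  simp only [Finset.coe_powerset, mem_preimage, mem_powerset_iff, Finite.coe_toFinset]
  exact subset_biUnion_of_mem (u := fun b : Finset ℕ => (b : Set ℕ)) hb

section

variable {P : Type*} {r : P → P → Prop}

theorem IsBarrier.exists_isBad {B : Set (Finset ℕ)} (hB : IsBarrier B) {f : Finset ℕ → P}
    (hf : IsBadOn r B f) : ∃ (A : Set ℕ) (F : Set ℕ → P), IsBad r A F ∧
    ∀ X ⊆ A, X.Infinite → ∃ b ∈ B, F X = f b := by
  have hβ : ∀ X : Set ℕ, ∃ b : Finset ℕ, X ⊆ (⋃ b ∈ B, (b : Set ℕ)) → X.Infinite →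
      b ∈ B ∧ SExtends X b := by
    intro X
    by_cases h : X.Infinite ∧ X ⊆ (⋃ b ∈ B, (b : Set ℕ))
    · obtain ⟨b, hb, hXb⟩ := hB.1.2 X h.1 h.2
      exact ⟨b, fun _ _ => ⟨hb, hXb⟩⟩
    · exact ⟨∅, fun h1 h2 => absurd ⟨h2, h1⟩ h⟩
  choose β hβ using hβ
  refine ⟨⋃ b ∈ B, (b : Set ℕ), fun X => f (β X), ⟨infinite_biUnion_of_infinite hB.1.1,
    fun X hX hXi => ?_, fun X hX hXi => ?_⟩, fun X hX hXi => ⟨β X, (hβ X hX hXi).1, rfl⟩⟩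
  · obtain ⟨h1, h2⟩ := hβ X hX hXi
    obtain ⟨h3, h4⟩ := hβ _ ((dropMin_subset X).trans hX) (dropMin_infinite hXi)
    refine hf _ h1 _ h3 (barrierPrec_of_sExtends hXi h2 h4 ?_ fun h => hB.2 _ h3 _ h1 h.symm)
    rw [Finset.nonempty_iff_ne_empty]
    intro h0
    obtain ⟨b, hb, hb0⟩ := (hB.1.1.sdiff (finite_singleton ∅)).nonempty
    exact hB.2 _ h1 b hb (fun h => hb0 (h.symm.trans h0)) (by rw [h0]; exact Finset.empty_subset b)
  · obtain ⟨h1, h2⟩ := hβ X hX hXi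
    refine ⟨(β X).sup id + 1, fun Y hY hYi hYX => ?_⟩
    obtain ⟨h3, h4⟩ := hβ Y hY hYi
    have h5 := SExtends.of_inter_Iio h2 hYX
    by_contra hne
    have hne' : β X ≠ β Y := fun h => hne (by rw [h])
    rcases SExtends.subset_or_subset h5 h4 with h | h
    · exact hB.2 _ h1 _ h3 hne' h
    · exact hB.2 _ h3 _ h1 hne'.symm h

/-- A better-quasi-order admits no locally constant bad array. -/
theorem IsBqo.not_isBad (hr : IsBqo r) (A : Set ℕ) (F : Set ℕ → P) : ¬ IsBad r A F := by
  intro hF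
  let Dec : Finset ℕ → Prop := fun s => s.Nonempty ∧ ∀ X ⊆ A, X.Infinite → SExtends X s →
    ∀ Y ⊆ A, Y.Infinite → SExtends Y s → F X = F Y
  let M : Finset ℕ → Prop := fun s => Dec s ∧ ∀ t : Finset ℕ, Dec t → SExtends ↑s t → t = s
  have hMex : ∀ X ⊆ A, X.Infinite → ∃ s, M s ∧ SExtends X s := by
    intro X hX hXi
    have hex : ∃ s, Dec s ∧ SExtends X s := by
      obtain ⟨m, hm⟩ := hF.locConst X hX hXi
      obtain ⟨a, haX, ham⟩ := hXi.exists_gt m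
      have hfin : (X ∩ Iio (a + 1)).Finite := (finite_Iio _).inter_of_right X
      have hmem : ∀ i, i ∈ hfin.toFinset ↔ i ∈ X ∧ i < a + 1 := fun i => by simp
      have ha : a ∈ hfin.toFinset := (hmem a).2 ⟨haX, by omega⟩
      have hval : ∀ Y ⊆ A, Y.Infinite → SExtends Y hfin.toFinset → F Y = F X := by
        intro Y hY hYi hYs
        refine hm Y hY hYi ?_
        ext i
        simp only [mem_inter_iff, mem_Iio]
        constructor
        · rintro ⟨h1, h2⟩
          exact ⟨((hmem i).1 (SExtends.mem hYs h1 ha (by omega))).1, h2⟩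
        · rintro ⟨h1, h2⟩
          exact ⟨SExtends.subset hYs ((hmem i).2 ⟨h1, by omega⟩), h2⟩
      refine ⟨hfin.toFinset, ⟨⟨a, ha⟩, fun Y hY hYi hYs Z hZ hZi hZs =>
        (hval Y hY hYi hYs).trans (hval Z hZ hZi hZs).symm⟩, sExtends_iff.2
        ⟨fun i hi => ((hmem i).1 hi).1, fun i hi j hj hij => (hmem i).2 ⟨hi, ?_⟩⟩⟩
      have := ((hmem j).1 hj).2
      omega
    obtain ⟨s, ⟨hs1, hs2⟩, hmin⟩ := exists_minimalFor_of_wellFoundedLT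
      (fun s => Dec s ∧ SExtends X s) Finset.card hex
    refine ⟨s, ⟨hs1, fun t ht hst => ?_⟩, hs2⟩
    have hts : t ⊆ s := SExtends.subset hst
    refine Finset.eq_of_subset_of_card_le hts (hmin ⟨ht, ?_⟩ (Finset.card_le_card hts))
    refine sExtends_iff.2 ⟨fun i hi => SExtends.subset hs2 (hts hi), fun i hi m hm him => ?_⟩
    exact SExtends.mem hst (SExtends.mem hs2 hi (hts hm) him) hm him
  have hthin : ∀ X s t, M s → M t → SExtends X s → SExtends X t → s = t := by
    have key : ∀ X s t, M s → M t → SExtends X s → SExtends X t → s ⊆ t → s = t :=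
      fun X s t hs ht hXs hXt hst => ht.2 s hs.1 (sExtends_iff.2 ⟨hst, fun i hi m hm him =>
        SExtends.mem hXs (SExtends.subset hXt hi) hm him⟩)
    intro X s t hs ht hXs hXt
    rcases SExtends.subset_or_subset hXs hXt with h | h
    · exact key X s t hs ht hXs hXt h
    · exact (key X t s ht hs hXt hXs h).symm
  obtain ⟨A', hA', hA'i, hU⟩ := exists_homogeneous
    (U := fun X => ∃ s t, M s ∧ SExtends X s ∧ M t ∧ t ⊆ s ∧ t ≠ s) hF.infinite (by
      rintro X hX hXi ⟨s, t, h1, h2, h3⟩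
      exact ⟨s.sup id + 1, fun Y _ _ hYX => ⟨s, t, h1, SExtends.of_inter_Iio h2 hYX, h3⟩⟩)
  have hext : ∀ s : Finset ℕ, ↑s ⊆ A' →
      ↑s ∪ above s A' ⊆ A' ∧ (↑s ∪ above s A').Infinite ∧ SExtends (↑s ∪ above s A') s :=
    fun s hs => ⟨union_subset hs (above_subset s A'),
      (infinite_above hA'i s).mono subset_union_right, sExtends_union_above s A'⟩
  rcases hU with hU | hU
  · have hno : ∀ n, ∀ s : Finset ℕ, M s → ↑s ⊆ A' → s.card = n → False := by
      intro n
      induction n using Nat.strong_induction_on with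
      | _ n ih =>
        intro s hs hsA hn
        obtain ⟨h1, h2, h3⟩ := hext s hsA
        obtain ⟨s', t, h4, h5, h6, h7, h8⟩ := hU _ h1 h2
        obtain rfl := hthin _ _ _ h4 hs h5 h3
        exact ih _ (hn ▸ Finset.card_lt_card (Finset.ssubset_iff_subset_ne.2 ⟨h7, h8⟩)) t h6
          (Subset.trans (Finset.coe_subset.2 h7) hsA) rfl
    obtain ⟨s, hs, hAs⟩ := hMex A' hA' hA'i
    exact hno _ s hs (SExtends.subset hAs) rfl
  · have hBar : IsBarrier {s | M s ∧ ↑s ⊆ A'} := by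
      refine ⟨⟨?_, ?_⟩, ?_⟩
      · intro hfin
        obtain ⟨N, hN⟩ := (hfin.image fun s : Finset ℕ => s.sup id).bddAbove
        obtain ⟨s, hs, hXs⟩ := hMex (A' ∩ Ici (N + 1)) (inter_subset_left.trans hA')
          (infinite_inter_Ici hA'i _)
        have hsub := SExtends.subset hXs
        obtain ⟨i, hi⟩ := hs.1.1
        have h1 : s.sup id ≤ N :=
          hN (mem_image_of_mem _ ⟨hs, hsub.trans inter_subset_left⟩)
        have h2 : i ≤ s.sup id := Finset.le_sup (f := id) hi
        have h3 : N + 1 ≤ i := (hsub hi).2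
        omega
      · intro X hXi hX
        have hXA : X ⊆ A' := hX.trans (iUnion₂_subset fun b hb => hb.2)
        obtain ⟨s, hs, hXs⟩ := hMex X (hXA.trans hA') hXi
        exact ⟨s, ⟨hs, (SExtends.subset hXs).trans hXA⟩, hXs⟩
      · intro t ht s hs hne hts
        obtain ⟨h1, h2, h3⟩ := hext s hs.2
        exact hU _ h1 h2 ⟨s, t, hs.1, h3, ht.1, hts, hne⟩
    refine hr _ hBar (fun s => F (↑s ∪ above s A')) ?_
    rintro b₁ ⟨hb₁, hb₁A⟩ b₂ ⟨hb₂, hb₂A⟩ ⟨m, k, i, hk, hkm, hi, rfl, rfl⟩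
    set c : Finset ℕ := (Finset.Icc 1 m).image i with hc
    have hcmem : ∀ x, x ∈ c ↔ ∃ j, (1 ≤ j ∧ j ≤ m) ∧ i j = x := fun x => by simp [hc]
    have hcA : ↑c ⊆ A' := by
      intro x hx
      obtain ⟨j, hj, rfl⟩ := (hcmem x).1 hx
      rcases hj.1.eq_or_lt with rfl | h
      · exact hb₁A (by simpa using ⟨1, ⟨le_rfl, hk⟩, rfl⟩)
      · exact hb₂A (by simpa using ⟨j, ⟨h, hj.2⟩, rfl⟩)
    obtain ⟨hX1, hX2, hX3⟩ := hext c hcA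
    set X : Set ℕ := ↑c ∪ above c A' with hXdef
    have hle : ∀ a b, 1 ≤ a → a ≤ m → 1 ≤ b → b ≤ m → i a ≤ i b → a ≤ b :=
      fun a b h1 h2 h3 h4 h => (hi.le_iff_le ⟨h1, h2⟩ ⟨h3, h4⟩).1 h
    have hi1 : i 1 ∈ c := (hcmem _).2 ⟨1, ⟨le_rfl, by omega⟩, rfl⟩
    have hmin : sInf X = i 1 := by
      refine le_antisymm (Nat.sInf_le (Or.inl hi1)) (le_csInf hX2.nonempty ?_)
      rintro x (hx | hx)
      · obtain ⟨j, hj, rfl⟩ := (hcmem x).1 hx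
        exact hi.monotoneOn ⟨le_rfl, by omega⟩ hj hj.1
      · exact (hx.2 _ hi1).le
    have h1 : SExtends X ((Finset.Icc 1 k).image i) := by
      refine sExtends_iff.2 ⟨fun x hx => ?_, fun x hx y hy hxy => ?_⟩
      · have hx' : x ∈ (Finset.Icc 1 k).image i := hx
        simp only [Finset.mem_image, Finset.mem_Icc] at hx'
        obtain ⟨j, hj, rfl⟩ := hx'
        exact Or.inl ((hcmem _).2 ⟨j, ⟨hj.1, by omega⟩, rfl⟩)
      · simp only [Finset.mem_image, Finset.mem_Icc] at hy ⊢
        obtain ⟨l, hl, rfl⟩ := hy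
        have hlc : i l ∈ c := (hcmem _).2 ⟨l, ⟨hl.1, by omega⟩, rfl⟩
        obtain ⟨j, hj, rfl⟩ := (hcmem x).1 (SExtends.mem hX3 hx hlc hxy)
        exact ⟨j, ⟨hj.1, (hle j l hj.1 hj.2 hl.1 (by omega) hxy).trans hl.2⟩, rfl⟩
    have h2 : SExtends (dropMin X) ((Finset.Icc 2 m).image i) := by
      refine sExtends_iff.2 ⟨fun x hx => ?_, fun x hx y hy hxy => ?_⟩
      · have hx' : x ∈ (Finset.Icc 2 m).image i := hx
        simp only [Finset.mem_image, Finset.mem_Icc] at hx'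
        obtain ⟨j, hj, rfl⟩ := hx'
        refine ⟨Or.inl ((hcmem _).2 ⟨j, ⟨by omega, hj.2⟩, rfl⟩), ?_⟩
        rw [hmin, mem_singleton_iff]
        exact (hi ⟨le_rfl, by omega⟩ ⟨by omega, hj.2⟩ (by omega)).ne'
      · simp only [Finset.mem_image, Finset.mem_Icc] at hy ⊢
        obtain ⟨l, hl, rfl⟩ := hy
        have hlc : i l ∈ c := (hcmem _).2 ⟨l, ⟨by omega, hl.2⟩, rfl⟩
        obtain ⟨j, hj, rfl⟩ := (hcmem x).1 (SExtends.mem hX3 hx.1 hlc hxy)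
        have hj1 : j ≠ 1 := by
          rintro rfl
          exact hx.2 hmin.symm
        exact ⟨j, ⟨by omega, hj.2⟩, rfl⟩
    have hXA := hX1.trans hA'
    have e1 := hext _ hb₁A
    have e2 := hext _ hb₂A
    simp only
    rw [hb₁.1.2 _ (e1.1.trans hA') e1.2.1 e1.2.2 X hXA hX2 h1,
      hb₂.1.2 _ (e2.1.trans hA') e2.2.1 e2.2.2 (dropMin X) ((dropMin_subset X).trans hXA)
        (dropMin_infinite hX2) h2]
    exact hF.bad X hXA hX2

/-- Ranked structures compared through a label in a better-quasi-order and families of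
substructures of smaller rank carry no bad array. -/
theorem not_isBad_of_label_of_sub [IsTrans P r] {Q I : Type*} [Finite I] {rq : Q → Q → Prop}
    (hQ : IsBqo rq) (rk : P → Ordinal.{u}) (label : P → Q) (sub : I → P → Set P)
    (hsub : ∀ ε a, ∀ s ∈ sub ε a, Below r rk s a)
    (hle : ∀ a b, rq (label a) (label b) → (∀ ε, ∀ s ∈ sub ε a, ∃ s' ∈ sub ε b, r s s') → r a b)
    (A₀ : Set ℕ) (f₀ : Set ℕ → P) : ¬ IsBad r A₀ f₀ := by
  intro h₀
  obtain ⟨A, f, hf, hmin⟩ := exists_minimal_isBad (rk := rk) h₀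
  obtain ⟨A₁, hA₁, hA₁i, h₁⟩ := exists_homogeneous hf.infinite
    (hf.locConst.map₂ hf.locConst.comp_dropMin fun a b => rq (label a) (label b)).openIn
  replace h₁ := h₁.resolve_right fun h => IsBqo.not_isBad hQ A₁ (fun X => label (f X))
    ⟨hA₁i, h, ((hf.locConst.map₂ hf.locConst fun a _ => label a)).mono hA₁⟩
  have hshrink : ∀ ε, ∀ B ⊆ A, B.Infinite → ∃ B' ⊆ B, B'.Infinite ∧ ∀ X ⊆ B', X.Infinite →
      ∀ s ∈ sub ε (f X), ∃ s' ∈ sub ε (f (dropMin X)), r s s' := by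
    intro ε B hB hBi
    have hfB := hf.locConst.mono hB
    obtain ⟨B', hB', hB'i, h⟩ := exists_homogeneous hBi
      (hfB.map₂ hfB.comp_dropMin fun a b => ∃ s ∈ sub ε a, ∀ s' ∈ sub ε b, ¬ r s s').openIn
    refine ⟨B', hB', hB'i, fun X hX hXi => ?_⟩
    rcases h with h | h
    · exfalso
      have hW : ∀ a b, ∃ s, (∃ s ∈ sub ε a, ∀ s' ∈ sub ε b, ¬ r s s') →
          s ∈ sub ε a ∧ ∀ s' ∈ sub ε b, ¬ r s s' := by
        intro a b
        by_cases hab : ∃ s ∈ sub ε a, ∀ s' ∈ sub ε b, ¬ r s s'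
        · obtain ⟨s, hs⟩ := hab
          exact ⟨s, fun _ => hs⟩
        · exact ⟨a, fun h => absurd h hab⟩
      choose W hW using hW
      have hfB' := hfB.mono hB'
      refine hmin B' (hB'.trans hB) (fun X => W (f X) (f (dropMin X))) ⟨hB'i, fun Y hY hYi => ?_,
        hfB'.map₂ hfB'.comp_dropMin W⟩ fun Y hY hYi => ?_
      · have hY' := (dropMin_subset Y).trans hY
        have hYi' := dropMin_infinite hYi
        exact (hW _ _ (h Y hY hYi)).2 _ (hW _ _ (h _ hY' hYi')).1
      · exact hsub ε _ _ (hW _ _ (h Y hY hYi)).1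
    · have := h X hX hXi
      push Not at this
      exact this
  have hall : ∀ F : Set I, ∃ B ⊆ A₁, B.Infinite ∧ ∀ ε ∈ F, ∀ X ⊆ B, X.Infinite →
      ∀ s ∈ sub ε (f X), ∃ s' ∈ sub ε (f (dropMin X)), r s s' := by
    intro F
    induction F, F.toFinite using Set.Finite.induction_on with
    | empty => exact ⟨A₁, Subset.rfl, hA₁i, by simp⟩
    | @insert ε F _ _ ih =>
      obtain ⟨B, h1, h2, h3⟩ := ih
      obtain ⟨B', h4, h5, h6⟩ := hshrink ε B (h1.trans hA₁) h2
      refine ⟨B', h4.trans h1, h5, fun δ hδ X hX hXi => ?_⟩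
      rcases hδ with rfl | hδ
      · exact h6 X hX hXi
      · exact h3 δ hδ X (hX.trans h4) hXi
  obtain ⟨B, h1, h2, h3⟩ := hall univ
  exact hf.bad B (h1.trans hA₁) h2
    (hle _ _ (h₁ B h1 h2) fun ε => h3 ε (mem_univ ε) B Subset.rfl h2)

end

end BadArray

theorem tendsto_smallSets_of_forall_selection {α : Type*} [TopologicalSpace α] {C : ℕ → Set α}
    {x : α} (hne : (∀ n, C n = ∅) ∨ ∀ n, (C n).Nonempty)
    (hC : ∀ a : ℕ → α, (∀ n, a n ∈ C n) → Tendsto a atTop (𝓝 x)) {U : Set α} (hU : U ∈ 𝓝 x) :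
    {n | ¬ C n ⊆ U}.Finite := by
  rcases hne with h | h
  · simp [h]
  · have hch : ∀ n, ∃ a ∈ C n, ¬ C n ⊆ U → a ∉ U := fun n => by
      by_cases hn : C n ⊆ U
      · exact ⟨_, (h n).some_mem, fun h' => absurd hn h'⟩
      · obtain ⟨a, ha, haU⟩ := not_subset.1 hn
        exact ⟨a, ha, fun _ => haU⟩
    choose a ha haU using hch
    have h1 := (hC a ha).eventually_mem hU
    rw [← Nat.cofinite_eq_atTop, eventually_cofinite] at h1
    exact h1.subset haU

section

variable {α : Type*} [LinearOrder α] {C : ℕ → Set α}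

theorem lt_of_forall_lt_succ (hne : (∀ n, C n = ∅) ∨ ∀ n, (C n).Nonempty)
    (hlt : ∀ n, ∀ a ∈ C n, ∀ b ∈ C (n + 1), a < b) {m n : ℕ} (hmn : m < n) {a b : α}
    (ha : a ∈ C m) (hb : b ∈ C n) : a < b := by
  induction n, hmn using Nat.le_induction generalizing b with
  | base => exact hlt m a ha b hb
  | succ n _ ih =>
    obtain ⟨c, hc⟩ := hne.resolve_left (fun h => by simp [h] at ha) n
    exact (ih hc).trans (hlt n c hc b hb)

theorem lt_of_forall_selection [TopologicalSpace α] [OrderClosedTopology α]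
    (hne : (∀ n, C n = ∅) ∨ ∀ n, (C n).Nonempty)
    (hlt : ∀ n, ∀ a ∈ C n, ∀ b ∈ C (n + 1), a < b) {x : α}
    (hC : ∀ a : ℕ → α, (∀ n, a n ∈ C n) → Tendsto a atTop (𝓝 x)) {n : ℕ} {a : α} (ha : a ∈ C n) :
    a < x := by
  have hne' := hne.resolve_left fun h => by simp [h] at ha
  choose b hb using hne'
  refine (hlt n a ha _ (hb _)).trans_le (ge_of_tendsto (hC b hb) ?_)
  filter_upwards [eventually_gt_atTop (n + 1)] with m hm
  exact (lt_of_forall_lt_succ hne hlt hm (hb _) (hb _)).le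

end

/-- Gluing along closed blocks shrinking to a point. -/
theorem continuousOn_insert_iUnion {ι ι' X Y : Type*} [TopologicalSpace X] [T2Space X]
    [TopologicalSpace Y] {C : ι → Set X} {D : ι' → Set Y} {x : X} {h : X → Y}
    (hclosed : ∀ i, IsClosed (C i)) (hx : ∀ i, x ∉ C i)
    (hdisj : ∀ i j z, z ∈ C i → z ∈ C j → i = j)
    (hC : ∀ U ∈ 𝓝 x, {i | ¬ C i ⊆ U}.Finite) (hD : ∀ U ∈ 𝓝 (h x), {i | ¬ D i ⊆ U}.Finite)
    {κ : ι → ι'} (hκ : κ.Injective) (hmaps : ∀ i, MapsTo h (C i) (D (κ i)))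
    (hcont : ∀ i, ContinuousOn h (C i)) : ContinuousOn h (insert x (⋃ i, C i)) := by
  intro y hy
  by_cases hyx : y = x
  · subst hyx
    refine fun U hU => mem_map.2 ?_
    have hfin : {i | ¬ D (κ i) ⊆ U}.Finite := (hD U hU).preimage hκ.injOn
    have h1 : (⋃ i ∈ {i | ¬ D (κ i) ⊆ U}, C i)ᶜ ∈ 𝓝 y :=
      (hfin.isClosed_biUnion fun i _ => hclosed i).isOpen_compl.mem_nhds (by simp [hx])
    filter_upwards [self_mem_nhdsWithin, mem_nhdsWithin_of_mem_nhds h1] with z hz hz1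
    rcases hz with rfl | hz
    · exact (mem_of_mem_nhds hU : h z ∈ U)
    · obtain ⟨i, hi⟩ := mem_iUnion.1 hz
      by_contra hzU
      refine hz1 (mem_biUnion (show ¬ D (κ i) ⊆ U from fun h' => hzU (h' (hmaps i hi))) hi)
  · obtain ⟨i, hi⟩ := mem_iUnion.1 (hy.resolve_left hyx)
    obtain ⟨U, V, hU, hV, hyU, hxV, hUV⟩ := t2_separation hyx
    have hfin : ({j | ¬ C j ⊆ V} \ {i}).Finite := (hC V (hV.mem_nhds hxV)).sdiff
    have h1 : (⋃ j ∈ {j | ¬ C j ⊆ V} \ {i}, C j)ᶜ ∈ 𝓝 y := by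
      refine (hfin.isClosed_biUnion fun i _ => hclosed i).isOpen_compl.mem_nhds ?_
      simp only [mem_compl_iff, mem_iUnion, not_exists]
      exact fun j hj hyj => hj.2 (hdisj j i y hyj hi)
    refine (hcont i y hi).mono_of_mem_nhdsWithin ?_
    filter_upwards [self_mem_nhdsWithin, mem_nhdsWithin_of_mem_nhds h1,
      mem_nhdsWithin_of_mem_nhds (hU.mem_nhds hyU)] with z hz hz1 hzU
    rcases hz with rfl | hz
    · exact absurd hxV (disjoint_left.1 hUV hzU)
    · obtain ⟨j, hj⟩ := mem_iUnion.1 hz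
      by_contra hzi
      refine hz1 (mem_biUnion ⟨fun h' => disjoint_left.1 hUV hzU (h' hj), ?_⟩ hj)
      rintro rfl
      exact hzi hj

namespace QCclo

variable {Q : Type}

/-- `L` is the sum `C false 0 + C false 1 + ⋯ + p + ⋯ + C true 1 + C true 0`, where blocks may be
empty and the block domains shrink to `x`. -/
structure IsSum (L : QCclo Q) (C : Bool → ℕ → QCclo Q) (p : Q) (x : ℝ) : Prop where
  dom_eq : L.dom = insert x (⋃ i : Bool × ℕ, (C i.1 i.2).dom)
  val_eq : ∀ ε n, ∀ y ∈ (C ε n).dom, L.val y = (C ε n).val y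
  val_center : L.val x = p
  lt_center : ∀ n, ∀ a ∈ (C false n).dom, a < x
  center_lt : ∀ n, ∀ a ∈ (C true n).dom, x < a
  lt_left : ∀ m n, m < n → ∀ a ∈ (C false m).dom, ∀ b ∈ (C false n).dom, a < b
  lt_right : ∀ m n, m < n → ∀ a ∈ (C true m).dom, ∀ b ∈ (C true n).dom, b < a
  shrink : ∀ U ∈ 𝓝 x, {i : Bool × ℕ | ¬ (C i.1 i.2).dom ⊆ U}.Finite

theorem IsSum.center_notMem {L : QCclo Q} {C : Bool → ℕ → QCclo Q} {p : Q} {x : ℝ}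
    (h : L.IsSum C p x) (i : Bool × ℕ) : x ∉ (C i.1 i.2).dom := by
  rcases i with ⟨_ | _, n⟩ <;> intro hx
  · exact (h.lt_center n x hx).false
  · exact (h.center_lt n x hx).false

theorem IsSum.eq_of_mem {L : QCclo Q} {C : Bool → ℕ → QCclo Q} {p : Q} {x : ℝ}
    (h : L.IsSum C p x) (i j : Bool × ℕ) (z : ℝ) (hi : z ∈ (C i.1 i.2).dom)
    (hj : z ∈ (C j.1 j.2).dom) : i = j := by
  rcases i with ⟨_ | _, m⟩ <;> rcases j with ⟨_ | _, n⟩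
  · rcases lt_trichotomy m n with hmn | rfl | hmn
    · exact absurd (h.lt_left m n hmn z hi z hj) (lt_irrefl z)
    · rfl
    · exact absurd (h.lt_left n m hmn z hj z hi) (lt_irrefl z)
  · exact absurd ((h.lt_center m z hi).trans (h.center_lt n z hj)) (lt_irrefl z)
  · exact absurd ((h.lt_center n z hj).trans (h.center_lt m z hi)) (lt_irrefl z)
  · rcases lt_trichotomy m n with hmn | rfl | hmn
    · exact absurd (h.lt_right m n hmn z hi z hj) (lt_irrefl z)
    · rfl
    · exact absurd (h.lt_right n m hmn z hj z hi) (lt_irrefl z)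

theorem _root_.IsOmegaSum.isSum {L : QCclo Q} {Ls Rs : ℕ → QCclo Q} {p : Q} {x : ℝ}
    (h : IsOmegaSum L Ls Rs p x) : L.IsSum (fun ε => bif ε then Rs else Ls) p x := by
  obtain ⟨hL, hR, -, hLL, -, hRR, hLx, hRx, hdom, hLv, hRv, hx⟩ := h
  have hL' : ∀ n, ∀ a ∈ (Ls n).dom, ∀ b ∈ (Ls (n + 1)).dom, a < b := by
    intro n a ha b hb
    rcases hLL n with h | h | ⟨c, h1, h2⟩
    · simp [h] at ha
    · simp [h] at hb
    · exact (h1 a ha).trans (h2 b hb)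
  have hR' : ∀ n, ∀ a ∈ (Rs n).dom, ∀ b ∈ (Rs (n + 1)).dom, b < a := by
    intro n a ha b hb
    rcases hRR n with h | h | ⟨c, h1, h2⟩
    · simp [h] at hb
    · simp [h] at ha
    · exact (h1 b hb).trans (h2 a ha)
  refine ⟨?_, ?_, hx, fun n a ha => ?_, fun n a ha => ?_, fun m n hmn a ha b hb => ?_,
    fun m n hmn a ha b hb => ?_, fun U hU => ?_⟩
  · rw [hdom]
    ext y
    simp only [mem_union, mem_iUnion, mem_singleton_iff, mem_insert_iff, Prod.exists,
      Bool.exists_bool, cond_false, cond_true]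
    tauto
  · rintro (_ | _) n y hy
    · exact hLv n y hy
    · exact hRv n y hy
  · exact lt_of_forall_selection (C := fun n => (Ls n).dom) hL hL' hLx ha
  · exact lt_of_forall_selection (α := ℝᵒᵈ) (C := fun n => (Rs n).dom) hR hR' hRx ha
  · exact lt_of_forall_lt_succ (C := fun n => (Ls n).dom) hL hL' hmn ha hb
  · exact lt_of_forall_lt_succ (α := ℝᵒᵈ) (C := fun n => (Rs n).dom) hR hR' hmn ha hb
  · refine (((tendsto_smallSets_of_forall_selection hL hLx hU).image (Prod.mk false)).union
      ((tendsto_smallSets_of_forall_selection hR hRx hU).image (Prod.mk true))).subset ?_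
    rintro ⟨_ | _, n⟩ hn
    · exact Or.inl ⟨n, hn, rfl⟩
    · exact Or.inr ⟨n, hn, rfl⟩

section

variable [Preorder Q]

theorem Emb.trans {A B C : QCclo Q} (h₁ : A.Emb B) (h₂ : B.Emb C) : A.Emb C := by
  obtain ⟨f, ⟨f1, f2, f3⟩, f4⟩ := h₁
  obtain ⟨g, ⟨g1, g2, g3⟩, g4⟩ := h₂
  exact ⟨g ∘ f, ⟨fun x hx => g1 _ (f1 x hx),
    fun x hx y hy hxy => g2 _ (f1 x hx) _ (f1 y hy) (f2 x hx y hy hxy), g3.comp f3 f1⟩,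
    fun a ha => (f4 a ha).trans (g4 _ (f1 a ha))⟩

theorem emb_of_subset {A B : QCclo Q} (h : A.dom ⊆ B.dom) (hval : ∀ a ∈ A.dom, A.val a ≤ B.val a) :
    A.Emb B :=
  ⟨id, ⟨h, fun _ _ _ _ => id, continuousOn_id⟩, hval⟩

theorem emb_of_dom_eq_empty {A B : QCclo Q} (h : A.dom = ∅) : A.Emb B :=
  emb_of_subset (by simp [h]) (by simp [h])

theorem IsSum.emb {L : QCclo Q} {C : Bool → ℕ → QCclo Q} {p : Q} {x : ℝ} (h : L.IsSum C p x)
    (ε : Bool) (n : ℕ) : (C ε n).Emb L := by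
  refine emb_of_subset ?_ fun a ha => (h.val_eq ε n a ha).ge
  rw [h.dom_eq]
  exact (subset_iUnion (fun i : Bool × ℕ => (C i.1 i.2).dom) (ε, n)).trans (subset_insert _ _)

theorem IsSum.emb_of_strictMono {L M : QCclo Q} {C D : Bool → ℕ → QCclo Q} {p q : Q} {x y : ℝ}
    (hL : L.IsSum C p x) (hM : M.IsSum D q y) (hpq : p ≤ q) {κ : Bool → ℕ → ℕ}
    (hκ : ∀ ε, StrictMono (κ ε)) (hCD : ∀ ε n, (C ε n).Emb (D ε (κ ε n))) : L.Emb M := by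
  classical
  choose f hf hfval using hCD
  let h : ℝ → ℝ := fun z =>
    if hz : ∃ i : Bool × ℕ, z ∈ (C i.1 i.2).dom then f hz.choose.1 hz.choose.2 z else y
  have hblock : ∀ ε n, EqOn h (f ε n) (C ε n).dom := by
    intro ε n z hz
    have hex : ∃ i : Bool × ℕ, z ∈ (C i.1 i.2).dom := ⟨(ε, n), hz⟩
    have heq := hL.eq_of_mem _ (ε, n) z hex.choose_spec hz
    simp only [h, dif_pos hex]
    rw [heq]
  have hcenter : h x = y := dif_neg fun ⟨i, hi⟩ => hL.center_notMem i hi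
  have hmaps : ∀ ε n, MapsTo h (C ε n).dom (D ε (κ ε n)).dom := fun ε n z hz => by
    rw [hblock ε n hz]
    exact (hf ε n).1 z hz
  have hmono : ∀ ε n, ∀ a ∈ (C ε n).dom, ∀ b ∈ (C ε n).dom, a < b → h a < h b :=
    fun ε n a ha b hb hab => by
      rw [hblock ε n ha, hblock ε n hb]
      exact (hf ε n).2.1 a ha b hb hab
  have hmem : ∀ z ∈ L.dom, z = x ∨ ∃ i : Bool × ℕ, z ∈ (C i.1 i.2).dom := fun z hz => by
    rw [hL.dom_eq] at hz
    simpa using hz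
  refine ⟨h, ⟨fun z hz => ?_, fun a ha b hb hab => ?_, ?_⟩, fun z hz => ?_⟩
  · rw [hM.dom_eq]
    rcases hmem z hz with rfl | ⟨i, hi⟩
    · exact Or.inl hcenter
    · exact Or.inr (mem_iUnion.2 ⟨(i.1, κ i.1 i.2), hmaps _ _ hi⟩)
  · rcases hmem a ha with rfl | ⟨⟨_ | _, m⟩, hm⟩ <;> rcases hmem b hb with rfl | ⟨⟨_ | _, n⟩, hn⟩
    · exact absurd hab (lt_irrefl _)
    · exact absurd (hL.lt_center n b hn) hab.not_gt
    · rw [hcenter]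
      exact hM.center_lt _ _ (hmaps _ _ hn)
    · rw [hcenter]
      exact hM.lt_center _ _ (hmaps _ _ hm)
    · rcases lt_trichotomy m n with hmn | rfl | hmn
      · exact hM.lt_left _ _ (hκ _ hmn) _ (hmaps _ _ hm) _ (hmaps _ _ hn)
      · exact hmono _ _ a hm b hn hab
      · exact absurd (hL.lt_left n m hmn b hn a hm) hab.not_gt
    · exact (hM.lt_center _ _ (hmaps _ _ hm)).trans (hM.center_lt _ _ (hmaps _ _ hn))
    · exact absurd (hL.center_lt m a hm) hab.not_gt
    · exact absurd ((hL.lt_center n b hn).trans (hL.center_lt m a hm)) hab.not_gt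
    · rcases lt_trichotomy m n with hmn | rfl | hmn
      · exact absurd (hL.lt_right m n hmn a hm b hn) hab.not_gt
      · exact hmono _ _ a hm b hn hab
      · exact hM.lt_right _ _ (hκ _ hmn) _ (hmaps _ _ hn) _ (hmaps _ _ hm)
  · rw [hL.dom_eq]
    refine continuousOn_insert_iUnion (D := fun i : Bool × ℕ => (D i.1 i.2).dom)
      (κ := fun i => (i.1, κ i.1 i.2)) (fun i => (C i.1 i.2).dom_closed) hL.center_notMem
      hL.eq_of_mem hL.shrink (hcenter.symm ▸ hM.shrink) ?_ (fun i => hmaps i.1 i.2)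
      fun i => (hf i.1 i.2).2.2.congr (hblock i.1 i.2)
    rintro ⟨ε, m⟩ ⟨δ, n⟩ h
    simp only [Prod.mk.injEq] at h
    obtain ⟨rfl, h⟩ := h
    rw [(hκ ε).injective h]
  · rcases hmem z hz with rfl | ⟨i, hi⟩
    · rwa [hcenter, hL.val_center, hM.val_center]
    · rw [hL.val_eq _ _ z hi, hM.val_eq _ _ _ (hmaps _ _ hi), hblock _ _ hi]
      exact hfval _ _ z hi

/-- Every term of the sequence embeds in a later one. -/
def Unbounded (D : ℕ → QCclo Q) : Prop := ∀ n, ∃ k > n, (D n).Emb (D k)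

theorem Unbounded.frequently {D : ℕ → QCclo Q} (hD : Unbounded D) {A : QCclo Q} {n : ℕ}
    (h : A.Emb (D n)) : ∃ᶠ k in atTop, A.Emb (D k) := by
  rw [frequently_atTop]
  intro N
  induction N with
  | zero => exact ⟨n, n.zero_le, h⟩
  | succ N ih =>
    obtain ⟨k, hk, hAk⟩ := ih
    obtain ⟨l, hl, hkl⟩ := hD k
    exact ⟨l, by omega, hAk.trans hkl⟩

theorem IsSum.emb_of_unbounded {L M : QCclo Q} {C D : Bool → ℕ → QCclo Q} {p q : Q} {x y : ℝ}
    (hL : L.IsSum C p x) (hM : M.IsSum D q y) (hpq : p ≤ q) (hD : ∀ ε, Unbounded (D ε))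
    (hCD : ∀ ε n, ∃ k, (C ε n).Emb (D ε k)) : L.Emb M := by
  have : ∀ ε, ∃ κ : ℕ → ℕ, StrictMono κ ∧ ∀ n, (C ε n).Emb (D ε (κ n)) := fun ε =>
    extraction_forall_of_frequently fun n => (hD ε).frequently (hCD ε n).choose_spec
  choose κ hκ hκ' using this
  exact hL.emb_of_strictMono hM hpq hκ hκ'

theorem cFam'_zero : CFam' Q (0 : Ordinal.{u}) = {L | L.dom = ∅ ∨ ∃ x : ℝ, L.dom = {x}} := by
  unfold CFam'
  exact Ordinal.limitRecOn_zero ..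

theorem cFam'_succ (α : Ordinal.{u}) :
    CFam' Q (Order.succ α) = S'Sum (CFam' Q α) ∪ CFam' Q α := by
  unfold CFam'
  exact Ordinal.limitRecOn_add_one ..

theorem mem_cFam'_of_isSuccLimit {α : Ordinal.{u}} (hα : Order.IsSuccLimit α) {L : QCclo Q} :
    L ∈ CFam' Q α ↔ ∃ β < α, L ∈ CFam' Q β := by
  have : CFam' Q α = ⋃ (β : Ordinal) (_ : β < α), CFam' Q β := by
    unfold CFam'
    exact Ordinal.limitRecOn_limit _ _ _ _ hα
  simp [this]

theorem exists_isSum_of_mem_cFam' {α : Ordinal.{u}} {L : QCclo Q} (hL : L ∈ CFam' Q α)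
    (hne : L.dom.Nonempty) (hmin : ∀ β < α, L ∉ CFam' Q β) :
    ∃ C p x, L.IsSum C p x ∧ (∀ ε, Unbounded (C ε)) ∧
      ∀ ε n, (C ε n).dom.Nonempty → ∃ β < α, C ε n ∈ CFam' Q β := by
  rcases Ordinal.zero_or_succ_or_isSuccLimit α with rfl | ⟨β, rfl⟩ | hα
  · rw [cFam'_zero] at hL
    obtain ⟨x, hx⟩ := hL.resolve_left hne.ne_empty
    refine ⟨fun _ _ => ⟨∅, countable_empty, isClosed_empty, L.val⟩, L.val x, x,
      ⟨?_, ?_, rfl, ?_, ?_, ?_, ?_, ?_⟩, fun _ n => ⟨n + 1, n.lt_succ_self, ?_⟩, ?_⟩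
    · simp [hx]
    all_goals simp [emb_of_dom_eq_empty]
  · rw [cFam'_succ] at hL
    obtain ⟨Ls, Rs, p, x, h, hLs, hRs, hLu, hRu⟩ :=
      hL.resolve_right (hmin β (Order.lt_succ β))
    refine ⟨_, p, x, h.isSum, ?_, ?_⟩
    · rintro (_ | _)
      · exact hLu
      · exact hRu
    · rintro (_ | _) n -
      · exact ⟨β, Order.lt_succ β, hLs n⟩
      · exact ⟨β, Order.lt_succ β, hRs n⟩
  · obtain ⟨β, hβ, h⟩ := (mem_cFam'_of_isSuccLimit hα).1 hL
    exact absurd h (hmin β hβ)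

open BadArray in
/-- Each level of the hierarchy of unbounded sums over a better-quasi-order is better-quasi-ordered
by embeddability. -/
theorem isBqoOn_cFam' (hQ : IsBqo (fun p q : Q => p ≤ q)) (α₀ : Ordinal.{u}) :
    IsBqoOn (Emb (Q := Q)) (CFam' Q α₀) := by
  intro B hB f hfB hbad
  obtain ⟨A, F, hF, hFB⟩ := IsBarrier.exists_isBad hB hbad
  let P := {L : QCclo Q // (∃ α : Ordinal.{u}, L ∈ CFam' Q α) ∧ L.dom.Nonempty}
  let r : P → P → Prop := fun L M => L.1.Emb M.1
  have : IsTrans P r := ⟨fun _ _ _ h₁ h₂ => Emb.trans h₁ h₂⟩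
  have hFP : ∀ X ⊆ A, X.Infinite →
      (∃ α : Ordinal.{u}, F X ∈ CFam' Q α) ∧ (F X).dom.Nonempty := by
    intro X hX hXi
    obtain ⟨b, hb, hXb⟩ := hFB X hX hXi
    refine ⟨⟨_, hXb ▸ hfB b hb⟩, ?_⟩
    by_contra hempty
    exact hF.bad X hX hXi (emb_of_dom_eq_empty (not_nonempty_iff_eq_empty.1 hempty))
  classical
  let G : Set ℕ → P := fun X => if h : X ⊆ A ∧ X.Infinite then ⟨F X, hFP X h.1 h.2⟩ else
    ⟨F A, hFP A Subset.rfl hF.infinite⟩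
  have hG : ∀ X ⊆ A, X.Infinite → (G X).1 = F X := fun X hX hXi => by
    simp only [G, dif_pos (And.intro hX hXi)]
  have hGbad : IsBad r A G := by
    refine ⟨hF.infinite, fun X hX hXi => ?_, fun X hX hXi => ?_⟩
    · simp only [r]
      rw [hG X hX hXi, hG _ ((dropMin_subset X).trans hX) (dropMin_infinite hXi)]
      exact hF.bad X hX hXi
    · obtain ⟨n, hn⟩ := hF.locConst X hX hXi
      refine ⟨n, fun Y hY hYi hYX => Subtype.ext ?_⟩
      rw [hG X hX hXi, hG Y hY hYi, hn Y hY hYi hYX]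
  let rk : P → Ordinal.{u} := fun L => sInf {α | L.1 ∈ CFam' Q α}
  have hdata : ∀ L : P, ∃ C p x, L.1.IsSum C p x ∧ (∀ ε, Unbounded (C ε)) ∧
      ∀ ε n, (C ε n).dom.Nonempty → ∃ β < rk L, C ε n ∈ CFam' Q β := fun L =>
    exists_isSum_of_mem_cFam' (csInf_mem L.2.1) L.2.2 fun β hβ =>
      notMem_of_lt_csInf' (s := {α : Ordinal.{u} | L.1 ∈ CFam' Q α}) hβ
  choose C p x hsum hunb hlow using hdata
  refine not_isBad_of_label_of_sub (r := r) hQ rk p (fun ε L => {s | ∃ n, s.1 = C L ε n})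
    ?_ ?_ A G hGbad
  · rintro ε L s ⟨n, hs⟩
    refine ⟨?_, ?_⟩
    · obtain ⟨β, hβ, h⟩ := hlow L ε n (hs ▸ s.2.2)
      exact (csInf_le' (s := {α : Ordinal.{u} | s.1 ∈ CFam' Q α})
        (show s.1 ∈ CFam' Q β from hs ▸ h)).trans_lt hβ
    · simp only [r]
      rw [hs]
      exact (hsum L).emb ε n
  · intro L M hLM hsub
    refine (hsum L).emb_of_unbounded (hsum M) hLM (hunb M) fun ε n => ?_
    rcases (C L ε n).dom.eq_empty_or_nonempty with h | h
    · exact ⟨0, emb_of_dom_eq_empty h⟩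
    · obtain ⟨β, -, hβ⟩ := hlow L ε n h
      obtain ⟨s', ⟨k, hk⟩, h'⟩ := hsub ε ⟨C L ε n, ⟨β, hβ⟩, h⟩ ⟨n, rfl⟩
      exact ⟨k, hk ▸ h'⟩

end

end QCclo

/-- If `(Q, ≤)` is a bqo, then `(C'_{ω₁}, ⪯)` is a bqo. -/
theorem stmt3 (Q : Type) [Preorder Q]
    (hQ : IsBqo (fun p q : Q => p ≤ q)) :
    IsBqoOn (QCclo.Emb (Q := Q)) (CFam' Q ((Cardinal.aleph 1).ord)) := 
  QCclo.isBqoOn_cFam' hQ _
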